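/- arXiv:1911.07375 — 2 statements merged into one kernel-verified Lean document; each statement's English description precedes it below -/
import Mathlib

section
/- For every ε ∈ (0, 1/2) and every monotone function f : {0,1}^n → {±1} whose optimal decision tree size is s ≥ 2, the algorithm BuildTopDownDT(f, ε) terminates after at most s^{√(log₂ s)/ε} splits, so regardless of how ties are broken TopDownDTSize(f, ε) ≤ s^{√(log₂ s)/ε} + 1. -/
/- Common definitions: decision trees, bare trees, influence, and the
   BuildTopDownDT top-down heuristic (modelled as a nondeterministic step
   relation, so that all tie-breakings are covered). -/

noncomputable section

namespace TopDownDT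

/-- Influence of variable `i` on a Boolean function over a finite index set
(`true` codes +1, `false` codes −1). -/
def influence {I : Type} [Fintype I] [DecidableEq I]
    (f : (I → Bool) → Bool) (i : I) : ℝ :=
  ((Finset.univ.filter fun x : I → Bool =>
      f x ≠ f (Function.update x i (!x i))).card : ℝ) / 2 ^ Fintype.card I

/-- Total influence. -/
def totalInfluence {I : Type} [Fintype I] [DecidableEq I]
    (f : (I → Bool) → Bool) : ℝ :=
  ∑ i : I, influence f i

variable {n : ℕ}

/-- Override inputs according to a partial assignment (earlier entries take precedence). -/
def override (π : List (Fin n × Bool)) (x : Fin n → Bool) : Fin n → Bool :=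
  fun i =>
    match π.find? (fun p => decide (p.1 = i)) with
    | some p => p.2
    | none => x i

/-- Restriction of `f` by the partial assignment `π` (as a function on the whole cube;
the fixed coordinates become irrelevant). -/
def restrictList (f : (Fin n → Bool) → Bool) (π : List (Fin n × Bool)) :
    (Fin n → Bool) → Bool :=
  fun x => f (override π x)

/-- Decision trees with ±1 leaves (`true` codes +1, `false` codes −1). -/
inductive DecTree (n : ℕ) : Type
  | leaf : Bool → DecTree n
  | node : Fin n → DecTree n → DecTree n → DecTree n
  deriving DecidableEq

/-- Evaluation of a decision tree. -/
def DecTree.eval : DecTree n → (Fin n → Bool) → Bool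
  | .leaf b, _ => b
  | .node i t0 t1, x => if x i then t1.eval x else t0.eval x

/-- Size (number of leaves) of a decision tree. -/
def DecTree.size : DecTree n → ℕ
  | .leaf _ => 1
  | .node _ t0 t1 => t0.size + t1.size

/-- Depth of a decision tree. -/
def DecTree.depth : DecTree n → ℕ
  | .leaf _ => 0
  | .node _ t0 t1 => max t0.depth t1.depth + 1

/-- Number of queries the tree makes on input `x` (the depth of the leaf reached by `x`). -/
def DecTree.pathLen : DecTree n → (Fin n → Bool) → ℕ
  | .leaf _, _ => 0
  | .node i t0 t1, x => (if x i then t1.pathLen x else t0.pathLen x) + 1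

/-- The optimal decision tree size of `f`: the least size of a decision tree computing `f`. -/
def optSize (f : (Fin n → Bool) → Bool) : ℕ :=
  sInf {s : ℕ | ∃ T : DecTree n, (∀ x, T.eval x = f x) ∧ T.size = s}

/-- Bare trees: decision trees with unlabeled leaves. -/
inductive BareTree (n : ℕ) : Type
  | leaf : BareTree n
  | node : Fin n → BareTree n → BareTree n → BareTree n
  deriving DecidableEq

/-- Size (number of leaves) of a bare tree. -/
def BareTree.size : BareTree n → ℕ
  | .leaf => 1
  | .node _ t0 t1 => t0.size + t1.size

/-- Root-to-leaf paths of a bare tree, recorded as lists of (variable, value) pairs. -/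
def BareTree.leafPaths : BareTree n → List (List (Fin n × Bool))
  | .leaf => [[]]
  | .node i t0 t1 =>
      (t0.leafPaths.map fun p => (i, false) :: p) ++
      (t1.leafPaths.map fun p => (i, true) :: p)

/-- Replace the leaf at the end of the path `π` by the bare tree `t`. -/
def BareTree.replaceLeaf : BareTree n → List (Fin n × Bool) → BareTree n → BareTree n
  | .leaf, [], t => t
  | .leaf, _ :: _, _ => .leaf
  | .node i t0 t1, [], _ => .node i t0 t1
  | .node i t0 t1, p :: ps, t =>
      if p.2 then .node i t0 (t1.replaceLeaf ps t)
      else .node i (t0.replaceLeaf ps t) t1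

/-- The `f`-completion: label each leaf `ℓ` by the sign of `E[f_ℓ]`. -/
def completionAux (f : (Fin n → Bool) → Bool) :
    BareTree n → List (Fin n × Bool) → DecTree n
  | .leaf, π =>
      .leaf (decide (2 ^ n ≤ 2 * (Finset.univ.filter fun x => restrictList f π x = true).card))
  | .node i t0 t1, π =>
      .node i (completionAux f t0 (π ++ [(i, false)]))
              (completionAux f t1 (π ++ [(i, true)]))

/-- The `f`-completion of a bare tree. -/
def completion (f : (Fin n → Bool) → Bool) (T : BareTree n) : DecTree n :=
  completionAux f T []

/-- Fraction of points of the cube on which `f` and `g` disagree. -/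
def errf (f g : (Fin n → Bool) → Bool) : ℝ :=
  ((Finset.univ.filter fun x => f x ≠ g x).card : ℝ) / 2 ^ n

/-- Error of the `f`-completion of a bare tree with respect to `f`. -/
def completionErr (f : (Fin n → Bool) → Bool) (T : BareTree n) : ℝ :=
  errf f (completion f T).eval

/-- Score of the leaf with path `π`: `2^{-|ℓ|} · max_i Inf_i(f_ℓ)`. -/
def leafScore (f : (Fin n → Bool) → Bool) (π : List (Fin n × Bool)) : ℝ :=
  ((1 : ℝ) / 2) ^ π.length * ⨆ i : Fin n, influence (restrictList f π) i

/-- `i` is a most influential variable of `g`. -/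
def IsMaxInfl (g : (Fin n → Bool) → Bool) (i : Fin n) : Prop :=
  ∀ j : Fin n, influence g j ≤ influence g i

/-- One step of BuildTopDownDT: replace a maximum-score leaf by a query to a most
influential variable of the corresponding restriction of `f`. -/
def SplitStep (f : (Fin n → Bool) → Bool) (T T' : BareTree n) : Prop :=
  ∃ π ∈ T.leafPaths, ∃ i : Fin n,
    (∀ π' ∈ T.leafPaths, leafScore f π' ≤ leafScore f π) ∧
    IsMaxInfl (restrictList f π) i ∧
    T' = T.replaceLeaf π (.node i .leaf .leaf)

/-- A (partial) run of `BuildTopDownDT(f, ε)` of length `m`, under an arbitrary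
tie-breaking rule: it starts from the single unlabeled leaf and, as long as the
`f`-completion is not an `ε`-approximation of `f`, performs a valid split. -/
def IsRun (f : (Fin n → Bool) → Bool) (ε : ℝ) (m : ℕ) (g : ℕ → BareTree n) : Prop :=
  g 0 = BareTree.leaf ∧
  ∀ j < m, ε < completionErr f (g j) ∧ SplitStep f (g j) (g (j + 1))

/-- Monotonicity of a Boolean function (with `false ≤ true`). -/
def MonotoneBF (f : (Fin n → Bool) → Bool) : Prop :=
  ∀ x y : Fin n → Bool, (∀ i, x i ≤ y i) → f x ≤ f y

/-- Cost of a bare tree relative to `f`:  `Σ_ℓ 2^{-|ℓ|} · Inf(f_ℓ)`. -/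
def costf (f : (Fin n → Bool) → Bool) (T : BareTree n) : ℝ :=
  (T.leafPaths.map fun π =>
    ((1 : ℝ) / 2) ^ π.length * totalInfluence (restrictList f π)).sum

/-- Variance of a Boolean function: `4 · Pr[f = −1] · Pr[f = +1]`. -/
def varf (f : (Fin n → Bool) → Bool) : ℝ :=
  4 * (((Finset.univ.filter fun x => f x = false).card : ℝ) / 2 ^ n) *
      (((Finset.univ.filter fun x => f x = true).card : ℝ) / 2 ^ n)

/-- Expectation `E[f(x)]` of a ±1-valued Boolean function over a uniform input. -/
def expVal (f : (Fin n → Bool) → Bool) : ℝ :=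
  (∑ x : Fin n → Bool, if f x then (1 : ℝ) else -1) / 2 ^ n

end TopDownDT

open TopDownDT

namespace TopDownDT

variable {n : ℕ}

/-- The expectation of a real-valued function over the uniform cube. -/
def mean (g : (Fin n → Bool) → ℝ) : ℝ :=
  (∑ x, g x) / 2 ^ n

/-- The `±1` value coded by a Boolean. -/
def sgn (b : Bool) : ℝ :=
  if b then 1 else -1

/-- The restriction of a function on the cube to `x i = b`. -/
def fixVar {α : Type*} (f : (Fin n → Bool) → α) (i : Fin n) (b : Bool) : (Fin n → Bool) → α :=
  fun x => f (Function.update x i b)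

lemma mean_add (g h : (Fin n → Bool) → ℝ) : mean (fun x => g x + h x) = mean g + mean h := by
  simp only [mean, Finset.sum_add_distrib, add_div]

lemma mean_sub (g h : (Fin n → Bool) → ℝ) : mean (fun x => g x - h x) = mean g - mean h := by
  simp only [mean, Finset.sum_sub_distrib, sub_div]

lemma mean_const_mul (c : ℝ) (g : (Fin n → Bool) → ℝ) :
    mean (fun x => c * g x) = c * mean g := by
  simp only [mean, ← Finset.mul_sum, mul_div_assoc]

lemma mean_const (c : ℝ) : mean (fun _ : Fin n → Bool => c) = c := by
  simp [mean]

lemma mean_sum {ι : Type*} (s : Finset ι) (g : ι → (Fin n → Bool) → ℝ) :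
    mean (fun x => ∑ i ∈ s, g i x) = ∑ i ∈ s, mean (g i) := by
  simp only [mean, ← Finset.sum_div]
  rw [Finset.sum_comm]

lemma mean_mono {g h : (Fin n → Bool) → ℝ} (H : ∀ x, g x ≤ h x) : mean g ≤ mean h :=
  div_le_div_of_nonneg_right (Finset.sum_le_sum fun x _ => H x) (by positivity)

lemma abs_mean_le (g : (Fin n → Bool) → ℝ) : |mean g| ≤ mean fun x => |g x| := by
  rw [mean, mean, abs_div, abs_of_pos (by positivity : (0 : ℝ) < 2 ^ n)]
  exact div_le_div_of_nonneg_right (Finset.abs_sum_le_sum_abs _ _) (by positivity)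

lemma mean_flip (g : (Fin n → Bool) → ℝ) (i : Fin n) :
    mean (fun x => g (Function.update x i (!x i))) = mean g := by
  have hinv : Function.Involutive fun x : Fin n → Bool => Function.update x i (!x i) := by
    intro x
    simp
  rw [mean, mean, hinv.bijective.sum_comp g]

lemma mean_eq_half_add_flip (g : (Fin n → Bool) → ℝ) (i : Fin n) :
    mean g = mean fun x => (1 / 2) * (g x + g (Function.update x i (!x i))) := by
  rw [mean_const_mul, mean_add, mean_flip]
  ring

lemma mean_eq_fixVar (g : (Fin n → Bool) → ℝ) (i : Fin n) :
    mean g = (mean (fun x => g (Function.update x i false)) +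
      mean fun x => g (Function.update x i true)) / 2 := by
  have h : mean (fun x => g (Function.update x i false) + g (Function.update x i true)) =
      2 * mean g := by
    rw [mean_eq_half_add_flip g i, ← mean_const_mul]
    congr 1
    funext x
    have hx : Function.update x i (x i) = x := Function.update_eq_self i x
    cases hi : x i <;> rw [hi] at hx
    · simp [hx]
    · simp [hx, add_comm]
  rw [mean_add] at h
  linarith

lemma sgn_mul_self (b : Bool) : sgn b * sgn b = 1 := by cases b <;> norm_num [sgn]

lemma abs_sgn (b : Bool) : |sgn b| = 1 := by cases b <;> norm_num [sgn]

lemma influence_eq_mean (g : (Fin n → Bool) → Bool) (i : Fin n) :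
    influence g i = mean fun x => if g x ≠ g (Function.update x i (!x i)) then 1 else 0 := by
  rw [influence, mean, Finset.sum_boole, Fintype.card_fin]

lemma errf_eq_mean (f g : (Fin n → Bool) → Bool) :
    errf f g = mean fun x => if f x ≠ g x then 1 else 0 := by
  rw [errf, mean, Finset.sum_boole]

lemma influence_nonneg (g : (Fin n → Bool) → Bool) (i : Fin n) : 0 ≤ influence g i := by
  unfold influence
  positivity

lemma totalInfluence_nonneg (g : (Fin n → Bool) → Bool) : 0 ≤ totalInfluence g :=
  Finset.sum_nonneg fun i _ => influence_nonneg g i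

lemma mean_abs_fixVar_sub (g : (Fin n → Bool) → Bool) (i : Fin n) (b : Bool) :
    mean (fun x => |sgn (fixVar g i b x) - sgn (g x)|) = influence g i := by
  rw [mean_eq_half_add_flip _ i, influence_eq_mean]
  congr 1
  funext x
  have hx : Function.update x i (x i) = x := Function.update_eq_self i x
  cases hi : x i <;> rw [hi] at hx <;> cases b <;>
    simp only [fixVar, hx, Function.update_idem, Bool.not_false, Bool.not_true] <;>
    generalize g (Function.update x i _) = u <;> generalize g x = v <;>
    cases u <;> cases v <;> norm_num [sgn]

lemma influence_fixVar_self (g : (Fin n → Bool) → Bool) (i : Fin n) (b : Bool) :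
    influence (fixVar g i b) i = 0 := by
  simp [influence, fixVar]

lemma influence_eq_fixVar (g : (Fin n → Bool) → Bool) {i j : Fin n} (hij : j ≠ i) :
    influence g j = (influence (fixVar g i false) j + influence (fixVar g i true) j) / 2 := by
  simp only [influence_eq_mean]
  rw [mean_eq_fixVar _ i]
  simp only [fixVar, Function.update_of_ne hij, Function.update_comm hij]

lemma totalInfluence_eq_fixVar (g : (Fin n → Bool) → Bool) (i : Fin n) :
    totalInfluence g = influence g i +
      (totalInfluence (fixVar g i false) + totalInfluence (fixVar g i true)) / 2 := by
  simp only [totalInfluence]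
  rw [← Finset.add_sum_erase _ _ (Finset.mem_univ i),
    ← Finset.add_sum_erase _ (fun j => influence (fixVar g i false) j) (Finset.mem_univ i),
    ← Finset.add_sum_erase _ (fun j => influence (fixVar g i true) j) (Finset.mem_univ i),
    influence_fixVar_self, influence_fixVar_self, zero_add, zero_add, ← Finset.sum_add_distrib,
    Finset.sum_div]
  congr 1
  exact Finset.sum_congr rfl fun j hj => influence_eq_fixVar g (Finset.ne_of_mem_erase hj)

/-- `HasTree f a`: some decision tree with at most `a` leaves computes `f`. -/
inductive HasTree : ((Fin n → Bool) → Bool) → ℕ → Prop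
  | const (b : Bool) (a : ℕ) (ha : 1 ≤ a) : HasTree (fun _ => b) a
  | node (f : (Fin n → Bool) → Bool) (i : Fin n) (a₀ a₁ a : ℕ)
      (h₀ : HasTree (fixVar f i false) a₀) (h₁ : HasTree (fixVar f i true) a₁)
      (ha : a₀ + a₁ ≤ a) : HasTree f a

lemma HasTree.one_le {f : (Fin n → Bool) → Bool} {a : ℕ} (h : HasTree f a) : 1 ≤ a := by
  induction h with
  | const _ _ ha => exact ha
  | node _ _ _ _ _ _ _ ha ih₀ ih₁ => omega

lemma HasTree.mono {f : (Fin n → Bool) → Bool} {a c : ℕ} (h : HasTree f a) (hac : a ≤ c) :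
    HasTree f c := by
  cases h with
  | const b _ ha => exact .const b c (ha.trans hac)
  | node _ i a₀ a₁ _ h₀ h₁ ha => exact .node f i a₀ a₁ c h₀ h₁ (ha.trans hac)

lemma fixVar_comm {α : Type*} (f : (Fin n → Bool) → α) {i j : Fin n} (hij : i ≠ j) (b c : Bool) :
    fixVar (fixVar f i b) j c = fixVar (fixVar f j c) i b := by
  funext x
  simp only [fixVar, Function.update_comm hij]

lemma HasTree.fixVar {f : (Fin n → Bool) → Bool} {a : ℕ} (h : HasTree f a) (j : Fin n)
    (c : Bool) : HasTree (TopDownDT.fixVar f j c) a := by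
  induction h with
  | const b a ha => exact .const b a ha
  | node f i a₀ a₁ a h₀ h₁ ha ih₀ ih₁ =>
    by_cases hij : i = j
    · subst hij
      cases c
      · exact h₀.mono (by omega)
      · exact h₁.mono (by omega)
    · refine .node _ i a₀ a₁ a ?_ ?_ ha
      · rw [fixVar_comm f (Ne.symm hij)]; exact ih₀
      · rw [fixVar_comm f (Ne.symm hij)]; exact ih₁

lemma DecTree.hasTree (T : DecTree n) : HasTree T.eval T.size := by
  induction T with
  | leaf b => exact .const b 1 le_rfl
  | node i t₀ t₁ ih₀ ih₁ =>
    refine .node _ i t₀.size t₁.size _ ?_ ?_ le_rfl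
    · convert ih₀.fixVar i false using 1
      funext x
      simp [TopDownDT.fixVar, DecTree.eval]
    · convert ih₁.fixVar i true using 1
      funext x
      simp [TopDownDT.fixVar, DecTree.eval]

lemma one_add_half_logb_add_le {a₀ a₁ a : ℕ} (h₀ : 1 ≤ a₀) (h₁ : 1 ≤ a₁) (ha : a₀ + a₁ ≤ a) :
    1 + (Real.logb 2 a₀ + Real.logb 2 a₁) / 2 ≤ Real.logb 2 a := by
  have h₀' : (1 : ℝ) ≤ a₀ := by exact_mod_cast h₀
  have h₁' : (1 : ℝ) ≤ a₁ := by exact_mod_cast h₁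
  have ha' : (a₀ : ℝ) + a₁ ≤ a := by exact_mod_cast ha
  have key : Real.logb 2 (2 ^ 2 * (a₀ * a₁)) ≤ Real.logb 2 ((a : ℝ) ^ 2) :=
    Real.logb_le_logb_of_le (by norm_num) (by positivity)
      (by nlinarith [sq_nonneg ((a₀ : ℝ) - a₁)])
  rw [Real.logb_mul (by norm_num) (by positivity), Real.logb_mul (by positivity) (by positivity),
    Real.logb_pow, Real.logb_pow, Real.logb_self_eq_one (by norm_num)] at key
  push_cast at key
  linarith

/-- The OSSS inequality, with average depth bounded by the logarithm of the size. -/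
lemma HasTree.abs_cov_le {f : (Fin n → Bool) → Bool} {a : ℕ} (h : HasTree f a)
    (g : (Fin n → Bool) → Bool) {M : ℝ} (hM : ∀ i, influence g i ≤ M) (hM0 : 0 ≤ M) :
    |mean (fun x => sgn (f x) * sgn (g x)) -
      mean (fun x => sgn (f x)) * mean (fun x => sgn (g x))| ≤ Real.logb 2 a * M := by
  induction h with
  | const b a ha =>
    rw [mean_const_mul, mean_const, sub_self, abs_zero]
    exact mul_nonneg (Real.logb_nonneg (by norm_num) (by exact_mod_cast ha)) hM0
  | node f i a₀ a₁ a h₀ h₁ ha ih₀ ih₁ =>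
    have hstep : ∀ b, |mean (fun x => sgn (TopDownDT.fixVar f i b x) *
        sgn (TopDownDT.fixVar g i b x)) -
        mean (fun x => sgn (TopDownDT.fixVar f i b x) * sgn (g x))| ≤ M := by
      intro b
      rw [← mean_sub]
      refine (abs_mean_le _).trans (le_trans (le_of_eq ?_) (hM i))
      rw [← mean_abs_fixVar_sub g i b]
      simp only [← mul_sub, abs_mul, abs_sgn, one_mul]
    have e₁ := mean_eq_fixVar (fun x => sgn (f x) * sgn (g x)) i
    have e₂ := mean_eq_fixVar (fun x => sgn (f x)) i
    have s₀ := abs_le.mp (hstep false)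
    have s₁ := abs_le.mp (hstep true)
    have t₀ := abs_le.mp ih₀
    have t₁ := abs_le.mp ih₁
    have hl := mul_le_mul_of_nonneg_right (one_add_half_logb_add_le h₀.one_le h₁.one_le ha) hM0
    rw [e₁, e₂]
    simp only [TopDownDT.fixVar] at *
    rw [abs_le]
    constructor <;> linarith [s₀.1, s₀.2, s₁.1, s₁.2, t₀.1, t₀.2, t₁.1, t₁.2]

lemma half_sqrt_add_sqrt_le {u v : ℝ} (hu : 0 ≤ u) (hv : 0 ≤ v) :
    (√u + √v) / 2 ≤ √((u + v) / 2) := by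
  apply Real.le_sqrt_of_sq_le
  nlinarith [sq_nonneg (√u - √v), Real.sq_sqrt hu, Real.sq_sqrt hv]

lemma mean_mul_sgn_eq_zero {g : (Fin n → Bool) → ℝ} {i : Fin n} (b : Bool) :
    mean (fun x => fixVar g i b x * sgn (x i)) = 0 := by
  rw [mean_eq_half_add_flip _ i, ← mean_const (n := n) 0]
  congr 1
  funext x
  simp only [fixVar, Function.update_idem, Function.update_self]
  cases x i <;> simp [sgn]

lemma mean_sgn_coord (i : Fin n) : mean (fun x => sgn (x i)) = 0 := by
  simpa [fixVar] using mean_mul_sgn_eq_zero (g := fun _ => 1) (i := i) true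

lemma sum_sgn_update (x : Fin n → Bool) (i : Fin n) (b : Bool) :
    ∑ j, sgn (Function.update x i b j) = ∑ j, sgn (x j) - sgn (x i) + sgn b := by
  rw [← Finset.add_sum_erase _ _ (Finset.mem_univ i),
    ← Finset.add_sum_erase _ (fun j => sgn (x j)) (Finset.mem_univ i), Function.update_self,
    Finset.sum_congr rfl fun j hj => by rw [Function.update_of_ne (Finset.ne_of_mem_erase hj)]]
  ring

lemma HasTree.mean_mul_sum_le {f : (Fin n → Bool) → Bool} {a : ℕ} (h : HasTree f a) (t : ℝ) :
    mean (fun x => sgn (f x) * (∑ j, sgn (x j) + t)) ≤ √(t ^ 2 + Real.logb 2 a) := by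
  induction h generalizing t with
  | const b a ha =>
    rw [mean_const_mul, mean_add, mean_const, mean_sum]
    simp only [mean_sgn_coord, Finset.sum_const_zero, zero_add]
    refine (le_abs_self _).trans ?_
    rw [abs_mul, abs_sgn, one_mul]
    have : 0 ≤ Real.logb 2 a := Real.logb_nonneg (by norm_num) (by exact_mod_cast ha)
    exact Real.abs_le_sqrt (by linarith)
  | node f i a₀ a₁ a h₀ h₁ ha ih₀ ih₁ =>
    have hstep : ∀ b, mean (fun x => sgn (f (Function.update x i b)) *
        (∑ j, sgn (Function.update x i b j) + t)) =
        mean (fun x => sgn (TopDownDT.fixVar f i b x) * (∑ j, sgn (x j) + (t + sgn b))) := by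
      intro b
      rw [← sub_zero (mean fun x => sgn (TopDownDT.fixVar f i b x) * _),
        ← mean_mul_sgn_eq_zero (g := fun x => sgn (f x)) (i := i) b, ← mean_sub]
      congr 1
      funext x
      simp only [TopDownDT.fixVar, sum_sgn_update]
      ring
    have l₀ : 0 ≤ Real.logb 2 a₀ :=
      Real.logb_nonneg (by norm_num) (by exact_mod_cast h₀.one_le)
    have l₁ : 0 ≤ Real.logb 2 a₁ :=
      Real.logb_nonneg (by norm_num) (by exact_mod_cast h₁.one_le)
    have hl := one_add_half_logb_add_le h₀.one_le h₁.one_le ha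
    rw [mean_eq_fixVar _ i, hstep, hstep]
    refine le_trans (div_le_div_of_nonneg_right (add_le_add (ih₀ _) (ih₁ _)) (by norm_num)) ?_
    refine (half_sqrt_add_sqrt_le (by positivity) (by positivity)).trans (Real.sqrt_le_sqrt ?_)
    simp only [sgn, if_true, Bool.false_eq_true, if_false]
    linarith

lemma influence_eq_mean_mul_sgn {f : (Fin n → Bool) → Bool} (hf : MonotoneBF f) (i : Fin n) :
    influence f i = mean fun x => sgn (f x) * sgn (x i) := by
  rw [influence_eq_mean, mean_eq_half_add_flip (fun x => sgn (f x) * sgn (x i)) i]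
  congr 1
  funext x
  cases hi : x i
  · have hle : f x ≤ f (Function.update x i true) := hf _ _ fun j => by
      by_cases hj : j = i
      · subst hj; simp [hi]
      · simp [hj]
    revert hle
    simp only [Bool.not_false, Function.update_self]
    generalize f (Function.update x i true) = u
    generalize f x = v
    cases u <;> cases v <;> norm_num [sgn]
  · have hle : f (Function.update x i false) ≤ f x := hf _ _ fun j => by
      by_cases hj : j = i
      · subst hj; simp
      · simp [hj]
    revert hle
    simp only [Bool.not_true, Function.update_self]
    generalize f (Function.update x i false) = u
    generalize f x = v
    cases u <;> cases v <;> norm_num [sgn]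

/-- The O'Donnell–Servedio bound on the total influence of a monotone function. -/
lemma HasTree.totalInfluence_le {f : (Fin n → Bool) → Bool} {a : ℕ} (h : HasTree f a)
    (hf : MonotoneBF f) : totalInfluence f ≤ √(Real.logb 2 a) := by
  have := h.mean_mul_sum_le 0
  simp only [add_zero, Finset.mul_sum, mean_sum] at this
  simpa [totalInfluence, influence_eq_mean_mul_sgn hf] using this

lemma override_cons (i : Fin n) (b : Bool) (π : List (Fin n × Bool)) (x : Fin n → Bool) :
    override ((i, b) :: π) x = Function.update (override π x) i b := by
  funext j
  by_cases hj : i = j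
  · subst hj; simp [override]
  · simp [override, hj, Function.update_of_ne (Ne.symm hj)]

lemma override_nil (x : Fin n → Bool) : override [] x = x := rfl

lemma override_append_singleton (π : List (Fin n × Bool)) (i : Fin n) (b : Bool)
    (x : Fin n → Bool) : override (π ++ [(i, b)]) x = override π (Function.update x i b) := by
  induction π with
  | nil => simp [override_cons, override_nil]
  | cons p π ih =>
    obtain ⟨j, c⟩ := p
    rw [List.cons_append, override_cons, override_cons, ih]

lemma override_update_of_mem {π : List (Fin n × Bool)} {i : Fin n} (hi : i ∈ π.map Prod.fst)
    (x : Fin n → Bool) (b : Bool) : override π (Function.update x i b) = override π x := by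
  induction π with
  | nil => simp at hi
  | cons p π ih =>
    obtain ⟨j, c⟩ := p
    rw [override_cons, override_cons]
    by_cases hmem : i ∈ π.map Prod.fst
    · rw [ih hmem]
    · obtain rfl : i = j := by simpa [hmem] using hi
      funext k
      by_cases hk : k = i
      · subst hk; simp
      · simp only [Function.update_of_ne hk, override]

lemma restrictList_append_singleton (f : (Fin n → Bool) → Bool) (π : List (Fin n × Bool))
    (i : Fin n) (b : Bool) :
    restrictList f (π ++ [(i, b)]) = fixVar (restrictList f π) i b := by
  funext x
  simp only [restrictList, fixVar, override_append_singleton]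

lemma HasTree.restrictList {f : (Fin n → Bool) → Bool} {a : ℕ} (h : HasTree f a)
    (π : List (Fin n × Bool)) : HasTree (restrictList f π) a := by
  induction π generalizing f with
  | nil => exact h
  | cons p π ih =>
    obtain ⟨i, b⟩ := p
    convert ih (h.fixVar i b) using 1
    funext x
    simp only [TopDownDT.restrictList, TopDownDT.fixVar, override_cons]

lemma influence_restrictList_of_mem (f : (Fin n → Bool) → Bool) {π : List (Fin n × Bool)}
    {i : Fin n} (hi : i ∈ π.map Prod.fst) : influence (restrictList f π) i = 0 := by
  simp [influence, restrictList, override_update_of_mem hi]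

/-- The error of the best constant approximation of `h`. -/
def leafErr (h : (Fin n → Bool) → Bool) : ℝ :=
  errf h fun _ => decide (2 ^ n ≤ 2 * (Finset.univ.filter fun x => h x = true).card)

lemma two_mul_leafErr_le (h : (Fin n → Bool) → Bool) :
    2 * leafErr h ≤ 1 - mean (fun x => sgn (h x)) * mean (fun x => sgn (h x)) := by
  set p : ℝ := mean fun x => if h x = true then 1 else 0 with hp
  have hp' : p = ((Finset.univ.filter fun x => h x = true).card : ℝ) / 2 ^ n := by
    simp [hp, mean]
  have hp0 : 0 ≤ p := by rw [hp']; positivity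
  have hp1 : p ≤ 1 := by
    rw [← mean_const (n := n) 1]
    exact mean_mono fun x => by split_ifs <;> norm_num
  have hsgn : mean (fun x => sgn (h x)) = 2 * p - 1 := by
    rw [hp, ← mean_const_mul, ← mean_const (n := n) 1, ← mean_sub, mean_const]
    congr 1
    funext x
    cases h x <;> norm_num [sgn]
  rw [hsgn, leafErr, errf_eq_mean]
  by_cases hc : 2 ^ n ≤ 2 * (Finset.univ.filter fun x => h x = true).card
  · have hhalf : 1 ≤ 2 * p := by
      rw [hp', ← mul_div_assoc, le_div_iff₀ (by positivity), one_mul]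
      exact_mod_cast hc
    have herr : (mean fun x => if h x ≠ true then (1 : ℝ) else 0) = 1 - p := by
      rw [hp, ← mean_const (n := n) 1, ← mean_sub, mean_const]
      congr 1
      funext x
      cases h x <;> simp
    simp only [hc, decide_true]
    rw [herr]
    nlinarith
  · have hhalf : 2 * p ≤ 1 := by
      rw [hp', ← mul_div_assoc, div_le_one (by positivity)]
      exact_mod_cast (not_le.mp hc).le
    have herr : (mean fun x => if h x ≠ false then (1 : ℝ) else 0) = p := by
      rw [hp]
      congr 1
      funext x
      cases h x <;> simp
    simp only [hc, decide_false]
    rw [herr]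
    nlinarith

lemma HasTree.two_mul_leafErr_le {h : (Fin n → Bool) → Bool} {a : ℕ} (ht : HasTree h a) :
    2 * leafErr h ≤ Real.logb 2 a * ⨆ i : Fin n, influence h i := by
  have hM : ∀ i, influence h i ≤ ⨆ i : Fin n, influence h i :=
    le_ciSup (Set.finite_range _).bddAbove
  have hM0 : 0 ≤ ⨆ i : Fin n, influence h i := Real.iSup_nonneg (influence_nonneg h)
  have hcov := (abs_le.mp (ht.abs_cov_le h hM hM0)).2
  simp only [sgn_mul_self, mean_const] at hcov
  exact (TopDownDT.two_mul_leafErr_le h).trans hcov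

/-- No path of the tree queries a variable twice, nor a variable of `L`. -/
def BareTree.ReadOnce : BareTree n → List (Fin n) → Prop
  | .leaf, _ => True
  | .node i t₀ t₁, L => i ∉ L ∧ t₀.ReadOnce (i :: L) ∧ t₁.ReadOnce (i :: L)

lemma BareTree.ReadOnce.replaceLeaf {T : BareTree n} {L : List (Fin n)} (hT : T.ReadOnce L)
    {π : List (Fin n × Bool)} (hπ : π ∈ T.leafPaths) {i : Fin n} (hiL : i ∉ L)
    (hi : i ∉ π.map Prod.fst) : (T.replaceLeaf π (.node i .leaf .leaf)).ReadOnce L := by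
  induction T generalizing L π with
  | leaf =>
    obtain rfl : π = [] := by simpa [BareTree.leafPaths] using hπ
    simp [BareTree.replaceLeaf, BareTree.ReadOnce, hiL]
  | node j t₀ t₁ ih₀ ih₁ =>
    obtain ⟨hj, h₀, h₁⟩ := hT
    simp only [BareTree.leafPaths, List.mem_append, List.mem_map] at hπ
    rcases hπ with ⟨ρ, hρ, rfl⟩ | ⟨ρ, hρ, rfl⟩ <;>
      simp only [List.map_cons, List.mem_cons, not_or] at hi
    · simpa [BareTree.replaceLeaf, BareTree.ReadOnce, hj, h₁] using
        ih₀ h₀ hρ (by simp [hi.1, hiL]) hi.2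
    · simpa [BareTree.replaceLeaf, BareTree.ReadOnce, hj, h₀] using
        ih₁ h₁ hρ (by simp [hi.1, hiL]) hi.2

lemma eval_completionAux_update (f : (Fin n → Bool) → Bool) {T : BareTree n} {L : List (Fin n)}
    (hT : T.ReadOnce L) (π : List (Fin n × Bool)) {i : Fin n} (hi : i ∈ L) (b : Bool)
    (x : Fin n → Bool) :
    (completionAux f T π).eval (Function.update x i b) = (completionAux f T π).eval x := by
  induction T generalizing L π with
  | leaf => rfl
  | node j t₀ t₁ ih₀ ih₁ =>
    obtain ⟨hj, h₀, h₁⟩ := hT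
    have hji : j ≠ i := fun h => hj (h ▸ hi)
    simp only [completionAux, DecTree.eval, Function.update_of_ne hji,
      ih₀ h₀ _ (List.mem_cons_of_mem _ hi), ih₁ h₁ _ (List.mem_cons_of_mem _ hi)]

lemma errf_completionAux (f : (Fin n → Bool) → Bool) {T : BareTree n} {L : List (Fin n)}
    (hT : T.ReadOnce L) (π : List (Fin n × Bool)) :
    errf (restrictList f π) (completionAux f T π).eval =
      (T.leafPaths.map fun ρ =>
        ((1 : ℝ) / 2) ^ ρ.length * leafErr (restrictList f (π ++ ρ))).sum := by
  induction T generalizing L π with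
  | leaf =>
    simp [BareTree.leafPaths, completionAux, leafErr]
    rfl
  | node i t₀ t₁ ih₀ ih₁ =>
    obtain ⟨-, h₀, h₁⟩ := hT
    have key : errf (restrictList f π) (completionAux f (.node i t₀ t₁) π).eval =
        1 / 2 * errf (restrictList f (π ++ [(i, false)]))
            (completionAux f t₀ (π ++ [(i, false)])).eval +
          1 / 2 * errf (restrictList f (π ++ [(i, true)]))
            (completionAux f t₁ (π ++ [(i, true)])).eval := by
      simp only [errf_eq_mean]
      rw [mean_eq_fixVar _ i]
      simp only [fixVar, restrictList_append_singleton, completionAux, DecTree.eval,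
        Function.update_self, if_true, Bool.false_eq_true, if_false,
        eval_completionAux_update f h₀ _ List.mem_cons_self,
        eval_completionAux_update f h₁ _ List.mem_cons_self]
      ring
    rw [key, ih₀ h₀, ih₁ h₁]
    simp only [BareTree.leafPaths, List.map_append, List.map_map, List.sum_append,
      ← List.sum_map_mul_left, Function.comp_def, List.length_cons, List.append_assoc,
      List.singleton_append, pow_succ', mul_assoc]

lemma completionErr_eq (f : (Fin n → Bool) → Bool) {T : BareTree n} (hT : T.ReadOnce []) :
    completionErr f T =
      (T.leafPaths.map fun π => ((1 : ℝ) / 2) ^ π.length * leafErr (restrictList f π)).sum :=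
  errf_completionAux f hT []

lemma BareTree.length_leafPaths (T : BareTree n) : T.leafPaths.length = T.size := by
  induction T with
  | leaf => rfl
  | node i t₀ t₁ ih₀ ih₁ => simp [BareTree.leafPaths, BareTree.size, ih₀, ih₁]

lemma BareTree.sum_leafPaths_replaceLeaf {T : BareTree n} {π : List (Fin n × Bool)}
    (hπ : π ∈ T.leafPaths) (i : Fin n) (φ : List (Fin n × Bool) → ℝ) :
    ((T.replaceLeaf π (.node i .leaf .leaf)).leafPaths.map φ).sum =
      (T.leafPaths.map φ).sum - φ π + φ (π ++ [(i, false)]) + φ (π ++ [(i, true)]) := by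
  induction T generalizing π φ with
  | leaf =>
    obtain rfl : π = [] := by simpa [BareTree.leafPaths] using hπ
    simp [BareTree.replaceLeaf, BareTree.leafPaths]
  | node j t₀ t₁ ih₀ ih₁ =>
    simp only [BareTree.leafPaths, List.mem_append, List.mem_map] at hπ
    rcases hπ with ⟨ρ, hρ, rfl⟩ | ⟨ρ, hρ, rfl⟩
    · have := ih₀ hρ fun p => φ ((j, false) :: p)
      simp [BareTree.replaceLeaf, BareTree.leafPaths, Function.comp_def, this]
      ring
    · have := ih₁ hρ fun p => φ ((j, true) :: p)
      simp [BareTree.replaceLeaf, BareTree.leafPaths, Function.comp_def, this]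
      ring

lemma BareTree.size_replaceLeaf {T : BareTree n} {π : List (Fin n × Bool)}
    (hπ : π ∈ T.leafPaths) (i : Fin n) :
    (T.replaceLeaf π (.node i .leaf .leaf)).size = T.size + 1 := by
  have h := BareTree.sum_leafPaths_replaceLeaf hπ i fun _ => 1
  simp only [List.map_const', List.sum_replicate, BareTree.length_leafPaths, nsmul_eq_mul,
    mul_one] at h
  have h' : ((T.replaceLeaf π (.node i .leaf .leaf)).size : ℝ) = (T.size : ℝ) + 1 := by linarith
  exact_mod_cast h'

lemma costf_nonneg (f : (Fin n → Bool) → Bool) (T : BareTree n) : 0 ≤ costf f T := by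
  refine List.sum_nonneg fun y hy => ?_
  obtain ⟨π, -, rfl⟩ := List.mem_map.mp hy
  exact mul_nonneg (by positivity) (totalInfluence_nonneg _)

lemma costf_leaf (f : (Fin n → Bool) → Bool) : costf f .leaf = totalInfluence f := by
  simp [costf, BareTree.leafPaths]
  rfl

lemma costf_replaceLeaf (f : (Fin n → Bool) → Bool) {T : BareTree n} {π : List (Fin n × Bool)}
    (hπ : π ∈ T.leafPaths) (i : Fin n) :
    costf f (T.replaceLeaf π (.node i .leaf .leaf)) =
      costf f T - ((1 : ℝ) / 2) ^ π.length * influence (restrictList f π) i := by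
  rw [costf, BareTree.sum_leafPaths_replaceLeaf hπ, costf]
  simp only [restrictList_append_singleton, List.length_append, List.length_singleton, pow_succ]
  rw [totalInfluence_eq_fixVar (restrictList f π) i]
  ring

lemma IsMaxInfl.iSup_eq {g : (Fin n → Bool) → Bool} {i : Fin n} (hi : IsMaxInfl g i) :
    ⨆ j : Fin n, influence g j = influence g i := by
  have : Nonempty (Fin n) := ⟨i⟩
  exact le_antisymm (ciSup_le hi)
    (le_ciSup (f := fun j => influence g j) (Set.finite_range _).bddAbove i)

lemma two_mul_completionErr_le {f : (Fin n → Bool) → Bool} {a : ℕ} (h : HasTree f a)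
    {T : BareTree n} (hT : T.ReadOnce []) {σ : ℝ} (hσ : ∀ π ∈ T.leafPaths, leafScore f π ≤ σ) :
    2 * completionErr f T ≤ T.size * (Real.logb 2 a * σ) := by
  have hlog : 0 ≤ Real.logb 2 a := Real.logb_nonneg (by norm_num) (by exact_mod_cast h.one_le)
  rw [completionErr_eq f hT, ← List.sum_map_mul_left, ← BareTree.length_leafPaths, ← nsmul_eq_mul]
  refine (List.sum_le_card_nsmul _ (Real.logb 2 a * σ) ?_).trans_eq (by simp)
  intro y hy
  obtain ⟨π, hπ, rfl⟩ := List.mem_map.mp hy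
  refine le_trans ?_ (mul_le_mul_of_nonneg_left (hσ π hπ) hlog)
  have := mul_le_mul_of_nonneg_left (h.restrictList π).two_mul_leafErr_le
    (by positivity : (0 : ℝ) ≤ (1 / 2) ^ π.length)
  rw [leafScore]
  linarith

lemma SplitStep.progress {f : (Fin n → Bool) → Bool} {a : ℕ} (h : HasTree f a)
    {T T' : BareTree n} (hT : T.ReadOnce []) (hstep : SplitStep f T T') {ε : ℝ} (hε : 0 < ε)
    (herr : ε < completionErr f T) :
    T'.ReadOnce [] ∧ T'.size = T.size + 1 ∧
      2 * ε ≤ T.size * (Real.logb 2 a * (costf f T - costf f T')) := by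
  obtain ⟨π, hπ, i, hmax, hi, rfl⟩ := hstep
  have hscore := two_mul_completionErr_le h hT hmax
  rw [leafScore, hi.iSup_eq] at hscore
  have hmem : i ∉ π.map Prod.fst := fun hmem => by
    rw [influence_restrictList_of_mem f hmem] at hscore
    linarith
  refine ⟨hT.replaceLeaf hπ (by simp) hmem, BareTree.size_replaceLeaf hπ i, ?_⟩
  rw [costf_replaceLeaf f hπ, sub_sub_cancel]
  linarith

lemma IsRun.invariant {f : (Fin n → Bool) → Bool} {a : ℕ} (h : HasTree f a)
    (hf : MonotoneBF f) {ε : ℝ} (hε : 0 < ε) {m : ℕ} {g : ℕ → BareTree n}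
    (hrun : IsRun f ε m g) {j : ℕ} (hj : j ≤ m) :
    (g j).ReadOnce [] ∧ (g j).size = j + 1 ∧
      2 * ε * Real.log (j + 1) ≤
        Real.logb 2 a * (√(Real.logb 2 a) - costf f (g j)) := by
  have hlog : 0 ≤ Real.logb 2 a :=
    Real.logb_nonneg (by norm_num) (by exact_mod_cast h.one_le)
  induction j with
  | zero =>
    rw [hrun.1]
    refine ⟨trivial, rfl, ?_⟩
    rw [costf_leaf]
    simpa using mul_nonneg hlog (sub_nonneg.mpr (h.totalInfluence_le hf))
  | succ j ih =>
    obtain ⟨hro, hsize, hcost⟩ := ih (by omega)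
    obtain ⟨herr, hstep⟩ := hrun.2 j (by omega)
    obtain ⟨hro', hsize', hdrop⟩ := hstep.progress h hro hε herr
    refine ⟨hro', by omega, ?_⟩
    have hj0 : (0 : ℝ) < j + 1 := by positivity
    have hlogstep : Real.log ((j : ℝ) + 1 + 1) ≤ Real.log (j + 1) + 1 / (j + 1) := by
      have := Real.log_le_sub_one_of_pos (by positivity : 0 < ((j : ℝ) + 1 + 1) / (j + 1))
      rw [Real.log_div (by positivity) (by positivity), add_div, div_self hj0.ne'] at this
      linarith
    rw [hsize] at hdrop
    push_cast at hdrop ⊢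
    have hdrop' : 2 * ε * (1 / ((j : ℝ) + 1)) ≤
        Real.logb 2 a * (costf f (g j) - costf f (g (j + 1))) := by
      rw [mul_one_div, div_le_iff₀ hj0]
      linarith
    have := mul_le_mul_of_nonneg_left hlogstep (by positivity : 0 ≤ 2 * ε)
    linarith

lemma hasTree_optSize {f : (Fin n → Bool) → Bool} (h : optSize f ≠ 0) :
    HasTree f (optSize f) := by
  have hne : {s : ℕ | ∃ T : DecTree n, (∀ x, T.eval x = f x) ∧ T.size = s}.Nonempty := by
    by_contra hempty
    rw [Set.not_nonempty_iff_eq_empty] at hempty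
    exact h (by rw [optSize, hempty, Nat.sInf_empty])
  obtain ⟨T, hT, hsize⟩ := Nat.sInf_mem hne
  rw [optSize, ← hsize, ← funext hT]
  exact T.hasTree

lemma IsRun.succ_le_rpow {f : (Fin n → Bool) → Bool} {a : ℕ} (h : HasTree f a)
    (hf : MonotoneBF f) {ε : ℝ} (hε : 0 < ε) {m : ℕ} {g : ℕ → BareTree n}
    (hrun : IsRun f ε m g) : (m : ℝ) + 1 ≤ (a : ℝ) ^ (√(Real.logb 2 a) / ε) := by
  have ha0 : (0 : ℝ) < a := by exact_mod_cast (by have := h.one_le; omega : 0 < a)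
  obtain ⟨-, -, hcost⟩ := hrun.invariant h hf hε le_rfl
  have hlog : 0 ≤ Real.logb 2 a :=
    Real.logb_nonneg (by norm_num) (by exact_mod_cast h.one_le)
  have hle : 2 * ε * Real.log (m + 1) ≤ Real.logb 2 a * √(Real.logb 2 a) :=
    hcost.trans (mul_le_mul_of_nonneg_left (sub_le_self _ (costf_nonneg f _)) hlog)
  have hlogb : Real.logb 2 a * Real.log 2 = Real.log a :=
    div_mul_cancel₀ _ (Real.log_pos (by norm_num)).ne'
  have hhalf : Real.logb 2 a ≤ 2 * Real.log a := by
    rw [← hlogb]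
    nlinarith [Real.log_two_gt_d9]
  have hfin : Real.log (m + 1) ≤ Real.log a * (√(Real.logb 2 a) / ε) := by
    rw [← mul_div_assoc, le_div_iff₀ hε]
    linarith [mul_le_mul_of_nonneg_right hhalf (Real.sqrt_nonneg (Real.logb 2 a))]
  rw [Real.rpow_def_of_pos ha0, ← Real.log_le_iff_le_exp (by positivity)]
  exact hfin

end TopDownDT

/-- For every `ε ∈ (0, 1/2)` and every monotone `f` with optimal
decision tree size `s ≥ 2`, `BuildTopDownDT(f, ε)` terminates after at most
`s^{√(log₂ s)/ε}` splits, so regardless of how ties are broken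
`TopDownDTSize(f, ε) ≤ s^{√(log₂ s)/ε} + 1`. -/
theorem buildTopDownDT_size_upper_bound_monotone
    {n : ℕ} (ε : ℝ) (hε0 : 0 < ε) (hε1 : ε < 1 / 2)
    (f : (Fin n → Bool) → Bool) (hmono : MonotoneBF f)
    (s : ℕ) (hs : optSize f = s) (hs2 : 2 ≤ s) :
    (¬ ∃ g : ℕ → BareTree n, g 0 = BareTree.leaf ∧
        ∀ j : ℕ, ε < completionErr f (g j) ∧ SplitStep f (g j) (g (j + 1))) ∧
    (∀ (m : ℕ) (g : ℕ → BareTree n), IsRun f ε m g →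
      (m : ℝ) ≤ (s : ℝ) ^ (Real.sqrt (Real.logb 2 s) / ε) ∧
      ((g m).size : ℝ) ≤ (s : ℝ) ^ (Real.sqrt (Real.logb 2 s) / ε) + 1) := by
  subst hs
  have htree := hasTree_optSize (f := f) (by omega)
  have hbound : ∀ (m : ℕ) (g : ℕ → BareTree n), IsRun f ε m g →
      (m : ℝ) + 1 ≤ (optSize f : ℝ) ^ (Real.sqrt (Real.logb 2 (optSize f)) / ε) :=
    fun m g hrun => hrun.succ_le_rpow htree hmono hε0
  refine ⟨?_, fun m g hrun => ⟨by linarith [hbound m g hrun], ?_⟩⟩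
  · rintro ⟨g, hg0, hg⟩
    obtain ⟨m, hm⟩ :=
      exists_nat_gt ((optSize f : ℝ) ^ (Real.sqrt (Real.logb 2 (optSize f)) / ε))
    linarith [hbound m g ⟨hg0, fun j _ => hg j⟩]
  · rw [(hrun.invariant htree hmono hε0 le_rfl).2.1]
    push_cast
    linarith [hbound m g hrun]
end
end

section
/- For every ε ∈ (0, 1/2) there exists a constant c > 0 (depending only on ε) such that for infinitely many n there is a function f : {0,1}^n → {±1} whose optimal decision tree size s satisfies s ≤ 2^{Õ(√n)}, yet — regardless of how ties are broken — TopDownDTSize(f, ε) ≥ s^{c·log₂(s)/(log₂ log₂ s)^3}. In particular, the top-down heuristic can output an ε-approximating tree of size s^{Ω̃(log s)} even though a tree of size s computes f exactly. -/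
/- Common definitions: decision trees, bare trees, influence, and the
   BuildTopDownDT top-down heuristic (modelled as a nondeterministic step
   relation, so that all tie-breakings are covered). -/

noncomputable section

open TopDownDT

namespace TopDownDT

/-! ### Bare trees and their paths -/

section Trees

variable {n : ℕ}

/-- The root-to-leaf path followed by the input `z`. -/
def BareTree.path : BareTree n → (Fin n → Bool) → List (Fin n × Bool)
  | .leaf, _ => []
  | .node i t0 t1, z => if z i then (i, true) :: t1.path z else (i, false) :: t0.path z

lemma BareTree.path_mem_leafPaths (T : BareTree n) (z : Fin n → Bool) :
    T.path z ∈ T.leafPaths := by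
  induction T with
  | leaf => simp [path, leafPaths]
  | node i t0 t1 h0 h1 => by_cases h : z i <;> simp [path, leafPaths, h, h0, h1]

lemma BareTree.path_congr (T : BareTree n) {z z' : Fin n → Bool}
    (h : ∀ p ∈ T.path z, z' p.1 = z p.1) : T.path z' = T.path z := by
  induction T with
  | leaf => rfl
  | node i t0 t1 h0 h1 => by_cases hi : z i <;> simp_all [path]

lemma completionAux_eval_congr (f : (Fin n → Bool) → Bool) (T : BareTree n)
    (π : List (Fin n × Bool)) {z z' : Fin n → Bool} (h : T.path z' = T.path z) :
    (completionAux f T π).eval z' = (completionAux f T π).eval z := by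
  induction T generalizing π with
  | leaf => rfl
  | node i t0 t1 h0 h1 =>
    by_cases hi : z i <;> by_cases hi' : z' i <;>
      simp_all [BareTree.path, completionAux, DecTree.eval]

lemma BareTree.mem_leafPaths_replaceLeaf (T : BareTree n) {π π' : List (Fin n × Bool)}
    {i : Fin n} (hπ : π ∈ T.leafPaths)
    (h : π' ∈ (T.replaceLeaf π (.node i .leaf .leaf)).leafPaths) :
    π' ∈ T.leafPaths ∨ ∃ v, π' = π ++ [(i, v)] := by
  induction T generalizing π π' with
  | leaf =>
    simp only [leafPaths, List.mem_singleton] at hπ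
    subst hπ
    simp only [replaceLeaf, leafPaths, List.map_cons, List.map_nil, List.cons_append,
      List.nil_append, List.mem_cons, List.not_mem_nil, or_false] at h
    right
    rcases h with h | h
    exacts [⟨false, by simp [h]⟩, ⟨true, by simp [h]⟩]
  | node j t0 t1 h0 h1 =>
    simp only [leafPaths, List.mem_append, List.mem_map] at hπ
    rcases hπ with ⟨ρ, hρ, rfl⟩ | ⟨ρ, hρ, rfl⟩
    · simp only [replaceLeaf, leafPaths, Bool.false_eq_true, if_false, List.mem_append,
        List.mem_map] at h ⊢
      rcases h with ⟨σ, hσ, rfl⟩ | h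
      · rcases h0 hρ hσ with h | ⟨v, rfl⟩
        · exact Or.inl (Or.inl ⟨σ, h, rfl⟩)
        · exact Or.inr ⟨v, rfl⟩
      · exact Or.inl (Or.inr h)
    · simp only [replaceLeaf, leafPaths, if_true, List.mem_append, List.mem_map] at h ⊢
      rcases h with h | ⟨σ, hσ, rfl⟩
      · exact Or.inl (Or.inl h)
      · rcases h1 hρ hσ with h | ⟨v, rfl⟩
        · exact Or.inl (Or.inr ⟨σ, h, rfl⟩)
        · exact Or.inr ⟨v, rfl⟩

lemma BareTree.size_pos (T : BareTree n) : 0 < T.size := by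
  induction T with
  | leaf => simp [size]
  | node i t0 t1 h0 h1 => simp only [size]; omega

lemma BareTree.size_le_size_replaceLeaf (T t : BareTree n) (π : List (Fin n × Bool)) :
    T.size ≤ (T.replaceLeaf π t).size := by
  induction T generalizing π with
  | leaf => cases π <;> simp [replaceLeaf, size, Nat.one_le_iff_ne_zero, t.size_pos.ne']
  | node j t0 t1 h0 h1 =>
    cases π with
    | nil => rfl
    | cons p ps =>
      by_cases hp : p.2 <;> simp [replaceLeaf, size, hp, h0 ps, h1 ps]

lemma BareTree.two_pow_le_size (T : BareTree n) {d : ℕ}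
    (h : ∀ π ∈ T.leafPaths, d ≤ π.length) : 2 ^ d ≤ T.size := by
  induction T generalizing d with
  | leaf =>
    have := h [] (by simp [leafPaths])
    simp_all [size]
  | node i t0 t1 h0 h1 =>
    cases d with
    | zero => exact BareTree.size_pos _
    | succ d =>
      have e0 := h0 (d := d) fun π hπ => by
        have := h ((i, false) :: π) (by simp [leafPaths, hπ])
        simpa using this
      have e1 := h1 (d := d) fun π hπ => by
        have := h ((i, true) :: π) (by simp [leafPaths, hπ])
        simpa using this
      simp only [size, pow_succ]
      omega

lemma size_le_of_isRun {f : (Fin n → Bool) → Bool} {ε : ℝ} {m : ℕ} {g : ℕ → BareTree n}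
    (hg : IsRun f ε m g) {j : ℕ} (hj : j ≤ m) : (g j).size ≤ (g m).size := by
  induction m, hj using Nat.le_induction with
  | base => rfl
  | succ m hm ih =>
    obtain ⟨π, -, i, -, -, h⟩ := (hg.2 m (by omega)).2
    refine (ih ⟨hg.1, fun k hk => hg.2 k (by omega)⟩).trans ?_
    rw [h]
    exact BareTree.size_le_size_replaceLeaf _ _ _

lemma override_of_notMem {π : List (Fin n × Bool)} {i : Fin n} (h : ∀ p ∈ π, p.1 ≠ i)
    (z : Fin n → Bool) : override π z i = z i := by
  have : π.find? (fun p => decide (p.1 = i)) = none := by simpa using h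
  simp [override, this]

lemma override_update {π : List (Fin n × Bool)} {i : Fin n} (h : ∀ p ∈ π, p.1 ≠ i)
    (z : Fin n → Bool) (v : Bool) :
    override π (Function.update z i v) = Function.update (override π z) i v := by
  funext k
  by_cases hk : k = i
  · subst hk
    simp [override_of_notMem h]
  · simp [override, Function.update_of_ne hk]

lemma influence_le_one (f : (Fin n → Bool) → Bool) (i : Fin n) : influence f i ≤ 1 := by
  unfold influence
  rw [div_le_one (by positivity)]
  exact_mod_cast (Finset.card_le_univ _).trans (by simp)

lemma leafScore_le (f : (Fin n → Bool) → Bool) (π : List (Fin n × Bool)) :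
    leafScore f π ≤ (1 / 2) ^ π.length := by
  unfold leafScore
  exact mul_le_of_le_one_right (by positivity)
    (Real.iSup_le (fun i => influence_le_one _ _) zero_le_one)

lemma le_leafScore (f : (Fin n → Bool) → Bool) (π : List (Fin n × Bool)) (i : Fin n) :
    (1 / 2) ^ π.length * influence (restrictList f π) i ≤ leafScore f π :=
  mul_le_mul_of_nonneg_left (le_ciSup (Set.finite_range _).bddAbove i) (by positivity)

/-! ### Optimal decision tree size -/

/-- The variables queried by a decision tree. -/
def DecTree.vars : DecTree n → Finset (Fin n)
  | .leaf _ => ∅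
  | .node i t0 t1 => insert i (t0.vars ∪ t1.vars)

lemma DecTree.card_vars_lt_size (T : DecTree n) : T.vars.card < T.size := by
  induction T with
  | leaf => simp [vars, size]
  | node i t0 t1 h0 h1 =>
    have := Finset.card_insert_le i (t0.vars ∪ t1.vars)
    have := Finset.card_union_le t0.vars t1.vars
    simp only [vars, size]
    omega

lemma DecTree.eval_update (T : DecTree n) {i : Fin n} (hi : i ∉ T.vars) (z : Fin n → Bool)
    (v : Bool) : T.eval (Function.update z i v) = T.eval z := by
  induction T with
  | leaf => rfl
  | node j t0 t1 h0 h1 =>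
    simp only [vars, Finset.mem_insert, Finset.mem_union, not_or] at hi
    simp [eval, h0 hi.2.1, h1 hi.2.2, Function.update_of_ne (Ne.symm hi.1)]

lemma DecTree.exists_query_list (L : List (Fin n)) (G : (Fin n → Bool) → DecTree n) {M : ℕ}
    (hG : ∀ x, (G x).size ≤ M) :
    ∃ T : DecTree n, T.size ≤ 2 ^ L.length * M ∧
      ∀ x, T.eval x = (G fun i => if i ∈ L then x i else false).eval x := by
  induction L generalizing G with
  | nil => exact ⟨G fun _ => false, by simpa using hG _, fun x => by simp⟩
  | cons i L ih =>
    have key : ∀ v : Bool, ∃ T : DecTree n, T.size ≤ 2 ^ L.length * M ∧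
        ∀ x, T.eval x = (G (Function.update (fun j => if j ∈ L then x j else false) i v)).eval x :=
      fun v => ih (fun x => G (Function.update x i v)) fun x => hG _
    obtain ⟨T0, hs0, he0⟩ := key false
    obtain ⟨T1, hs1, he1⟩ := key true
    refine ⟨.node i T0 T1, ?_, fun x => ?_⟩
    · simp only [size, List.length_cons, pow_succ]
      nlinarith
    · have hx : Function.update (fun j => if j ∈ L then x j else false) i (x i) =
          fun j => if j ∈ i :: L then x j else false := by
        funext j
        by_cases hj : j = i
        · subst hj; simp
        · simp [hj]
      rw [← hx]
      cases h : x i <;> simp [eval, h, he0, he1]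

lemma DecTree.optSize_le {f : (Fin n → Bool) → Bool} {T : DecTree n}
    (h : ∀ x, T.eval x = f x) : optSize f ≤ T.size :=
  Nat.sInf_le ⟨T, h, rfl⟩

lemma DecTree.exists_size_eq_optSize (f : (Fin n → Bool) → Bool) :
    ∃ T : DecTree n, (∀ x, T.eval x = f x) ∧ T.size = optSize f := by
  obtain ⟨T, -, hT⟩ := DecTree.exists_query_list (List.finRange n) (fun x => .leaf (f x))
    (M := 1) (fun x => le_rfl)
  exact Nat.sInf_mem (s := {s | ∃ T : DecTree n, (∀ x, T.eval x = f x) ∧ T.size = s})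
    ⟨T.size, T, fun x => by simp [hT, eval], rfl⟩

end Trees

/-! ### The multiplexed parity -/

section Tribes

variable {J : Type} {B w : ℕ}

/-- The assignment making a tribe of width `w` true. -/
def allTrue (w : ℕ) : Fin w → Bool := fun _ => true

open Classical in
/-- The block of some tribe satisfying the predicate `P`, if there is one. -/
def selectOf (blk : J → Fin B) (P : J → Prop) : Option (Fin B) :=
  if h : ∃ j, P j then some (blk h.choose) else none

/-- The block of some satisfied tribe, if there is one. -/
def select (blk : J → Fin B) (x : J → Fin w → Bool) : Option (Fin B) :=
  selectOf blk fun j => x j = allTrue w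

lemma select_congr (blk : J → Fin B) {x x' : J → Fin w → Bool}
    (h : ∀ j, x' j = allTrue w ↔ x j = allTrue w) : select blk x' = select blk x := by
  unfold select
  rw [funext fun j => propext (h j)]

lemma exists_of_select_eq_some {blk : J → Fin B} {x : J → Fin w → Bool} {β : Fin B}
    (h : select blk x = some β) : ∃ j, x j = allTrue w ∧ blk j = β := by
  unfold select selectOf at h
  split_ifs at h with hx
  exact ⟨_, hx.choose_spec, by simpa using h⟩

lemma forall_of_select_eq_none {blk : J → Fin B} {x : J → Fin w → Bool}
    (h : select blk x = none) (j : J) : x j ≠ allTrue w := by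
  unfold select selectOf at h
  split_ifs at h with hx
  exact fun hj => hx ⟨j, hj⟩

lemma select_eq_of_unique {blk : J → Fin B} {x : J → Fin w → Bool} {j : J}
    (hj : x j = allTrue w) (h : ∀ k, k ≠ j → x k ≠ allTrue w) : select blk x = some (blk j) := by
  have hx : ∃ j, x j = allTrue w := ⟨j, hj⟩
  have : hx.choose = j := by
    by_contra hne
    exact h _ hne hx.choose_spec
  unfold select selectOf
  rw [dif_pos hx, this]

variable [Fintype J] [DecidableEq J]

lemma card_filter_forall_mem (S : J → Finset (Fin w → Bool)) :
    (Finset.univ.filter fun x : J → Fin w → Bool => ∀ j, x j ∈ S j).card = ∏ j, (S j).card := by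
  rw [← Fintype.card_piFinset]
  congr 1
  ext x
  simp

lemma card_filter_apply_mem (j : J) (S : Finset (Fin w → Bool)) :
    (Finset.univ.filter fun x : J → Fin w → Bool => x j ∈ S).card =
      S.card * (2 ^ w) ^ (Fintype.card J - 1) := by
  have h := card_filter_forall_mem (w := w)
    (fun k : J => if k = j then S else (Finset.univ : Finset (Fin w → Bool)))
  have e : (Finset.univ.filter fun x : J → Fin w → Bool =>
      ∀ k, x k ∈ if k = j then S else (Finset.univ : Finset (Fin w → Bool))) =
      Finset.univ.filter fun x : J → Fin w → Bool => x j ∈ S := by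
    ext x
    simp only [Finset.mem_filter, Finset.mem_univ, true_and]
    refine ⟨fun h => by simpa using h j, fun h k => ?_⟩
    by_cases hk : k = j
    · subst hk; simpa using h
    · simp [hk]
  rw [e] at h
  rw [h, ← Finset.mul_prod_erase _ _ (Finset.mem_univ j), if_pos rfl]
  congr 1
  rw [Finset.prod_congr rfl (g := fun _ => 2 ^ w), Finset.prod_const,
    Finset.card_erase_of_mem (Finset.mem_univ j), Finset.card_univ]
  intro k hk
  rw [if_neg (Finset.ne_of_mem_erase hk)]
  simp

lemma card_filter_unique (j : J) :
    (Finset.univ.filter fun x : J → Fin w → Bool =>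
      x j = allTrue w ∧ ∀ k, k ≠ j → x k ≠ allTrue w).card =
      (2 ^ w - 1) ^ (Fintype.card J - 1) := by
  have h := card_filter_forall_mem (w := w)
    (fun k : J => if k = j then {allTrue w} else {allTrue w}ᶜ)
  have e : (Finset.univ.filter fun x : J → Fin w → Bool =>
      ∀ k, x k ∈ if k = j then {allTrue w} else ({allTrue w} : Finset (Fin w → Bool))ᶜ) =
      Finset.univ.filter fun x : J → Fin w → Bool =>
        x j = allTrue w ∧ ∀ k, k ≠ j → x k ≠ allTrue w := by
    ext x
    simp only [Finset.mem_filter, Finset.mem_univ, true_and]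
    refine ⟨fun h => ⟨by simpa using h j, fun k hk => by simpa [hk] using h k⟩, fun h k => ?_⟩
    by_cases hk : k = j
    · subst hk; simpa using h.1
    · simpa [hk] using h.2 k hk
  rw [e] at h
  rw [h, ← Finset.mul_prod_erase _ _ (Finset.mem_univ j), if_pos rfl, Finset.card_singleton,
    one_mul, Finset.prod_congr rfl (g := fun _ => 2 ^ w - 1), Finset.prod_const,
    Finset.card_erase_of_mem (Finset.mem_univ j), Finset.card_univ]
  intro k hk
  rw [if_neg (Finset.ne_of_mem_erase hk), Finset.card_compl]
  simp

lemma card_filter_select_none_le (blk : J → Fin B) :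
    (Finset.univ.filter fun x : J → Fin w → Bool => select blk x = none).card ≤
      (2 ^ w - 1) ^ Fintype.card J := by
  have h := card_filter_forall_mem (w := w) (fun _ : J => {allTrue w}ᶜ)
  simp only [Finset.card_compl, Finset.prod_const, Finset.card_univ, Finset.card_singleton,
    Fintype.card_fun, Fintype.card_bool, Fintype.card_fin] at h
  rw [← h]
  refine Finset.card_le_card fun x hx => ?_
  simp only [Finset.mem_filter, Finset.mem_univ, true_and, Finset.mem_compl,
    Finset.mem_singleton] at hx ⊢
  exact forall_of_select_eq_none hx

lemma card_filter_select_mem_le (blk : J → Fin B) {C : ℕ}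
    (hC : ∀ β, (Finset.univ.filter fun j => blk j = β).card ≤ C) (E : Finset (Fin B)) :
    (Finset.univ.filter fun x : J → Fin w → Bool => ∃ β ∈ E, select blk x = some β).card ≤
      E.card * C * (2 ^ w) ^ (Fintype.card J - 1) := by
  have hsub : (Finset.univ.filter fun x : J → Fin w → Bool => ∃ β ∈ E, select blk x = some β) ⊆
      E.biUnion fun β => (Finset.univ.filter fun j => blk j = β).biUnion fun j =>
        Finset.univ.filter fun x : J → Fin w → Bool =>
          x j ∈ ({allTrue w} : Finset (Fin w → Bool)) := by
    intro x hx
    simp only [Finset.mem_filter, Finset.mem_univ, true_and] at hx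
    obtain ⟨β, hβ, hx⟩ := hx
    obtain ⟨j, hj, rfl⟩ := exists_of_select_eq_some hx
    simp only [Finset.mem_biUnion, Finset.mem_filter, Finset.mem_univ, true_and,
      Finset.mem_singleton]
    exact ⟨_, hβ, j, rfl, hj⟩
  refine (Finset.card_le_card hsub).trans ?_
  rw [mul_assoc]
  refine Finset.card_biUnion_le_card_mul _ _ _ fun β _ => ?_
  refine (Finset.card_biUnion_le_card_mul _ _ _ fun j _ => ?_).trans
    (Nat.mul_le_mul_right _ (hC β))
  rw [card_filter_apply_mem]
  simp

lemma le_card_filter_select_eq (blk : J → Fin B) (β : Fin B) {C : ℕ}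
    (hC : C ≤ (Finset.univ.filter fun j => blk j = β).card) :
    C * (2 ^ w - 1) ^ (Fintype.card J - 1) ≤
      (Finset.univ.filter fun x : J → Fin w → Bool => select blk x = some β).card := by
  have hsub : ((Finset.univ.filter fun j => blk j = β).biUnion fun j =>
        Finset.univ.filter fun x : J → Fin w → Bool =>
          x j = allTrue w ∧ ∀ k, k ≠ j → x k ≠ allTrue w) ⊆
      Finset.univ.filter fun x : J → Fin w → Bool => select blk x = some β := by
    intro x hx
    simp only [Finset.mem_biUnion, Finset.mem_filter, Finset.mem_univ, true_and] at hx ⊢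
    obtain ⟨j, rfl, hj, hk⟩ := hx
    exact select_eq_of_unique hj hk
  refine le_trans ?_ (Finset.card_le_card hsub)
  rw [Finset.card_biUnion]
  · simp only [card_filter_unique, Finset.sum_const, smul_eq_mul]
    exact Nat.mul_le_mul_right _ hC
  · intro j _ k _ hjk
    refine Finset.disjoint_left.2 fun x hx hx' => ?_
    simp only [Finset.mem_filter, Finset.mem_univ, true_and] at hx hx'
    exact hx'.2 j hjk hx.1

end Tribes

section Mux

variable {J : Type} {n B w b : ℕ}

/-- The address part of an input. -/
def xPart (e : Fin n ≃ (J × Fin w) ⊕ (Fin B × Fin b)) (z : Fin n → Bool) : J → Fin w → Bool :=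
  fun j t => z (e.symm (.inl (j, t)))

/-- The data part of an input. -/
def yPart (e : Fin n ≃ (J × Fin w) ⊕ (Fin B × Fin b)) (z : Fin n → Bool) :
    Fin B × Fin b → Bool :=
  fun k => z (e.symm (.inr k))

/-- The parity of a bit string. -/
def parity (y : Fin b → Bool) : Bool :=
  decide (∑ k, (if y k then 1 else 0 : ZMod 2) = 1)

/-- The parity of the data block selected by the address tribes. -/
def muxParity (blk : J → Fin B) (e : Fin n ≃ (J × Fin w) ⊕ (Fin B × Fin b))
    (z : Fin n → Bool) : Bool :=
  match select blk (xPart e z) with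
  | none => false
  | some β => parity fun k => yPart e z (β, k)

/-- Every variable occurring in `π` is a data variable. -/
def DataOnly (e : Fin n ≃ (J × Fin w) ⊕ (Fin B × Fin b)) (π : List (Fin n × Bool)) : Prop :=
  ∀ p ∈ π, ∃ k, p.1 = e.symm (.inr k)

/-- Splitting the cube into address and data parts. -/
def splitEquiv (e : Fin n ≃ (J × Fin w) ⊕ (Fin B × Fin b)) :
    (Fin n → Bool) ≃ (J → Fin w → Bool) × (Fin B × Fin b → Bool) where
  toFun z := (xPart e z, yPart e z)
  invFun p i := (e i).elim (fun q => p.1 q.1 q.2) p.2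
  left_inv z := by
    funext i
    obtain ⟨q, rfl⟩ := e.symm.surjective i
    rcases q with q | q <;> simp [xPart, yPart]
  right_inv p := by
    ext <;> simp [xPart, yPart]

lemma parity_update (y : Fin b → Bool) (k : Fin b) :
    parity (Function.update y k (!y k)) = !parity y := by
  have h : ∀ y' : Fin b → Bool, ∑ j, (if y' j then 1 else 0 : ZMod 2) =
      (if y' k then 1 else 0) + ∑ j ∈ Finset.univ.erase k, (if y' j then 1 else 0 : ZMod 2) :=
    fun y' => (Finset.add_sum_erase _ _ (Finset.mem_univ k)).symm
  have h2 : ∑ j ∈ Finset.univ.erase k, (if Function.update y k (!y k) j then 1 else 0 : ZMod 2) =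
      ∑ j ∈ Finset.univ.erase k, (if y j then 1 else 0 : ZMod 2) :=
    Finset.sum_congr rfl fun j hj => by rw [Function.update_of_ne (Finset.ne_of_mem_erase hj)]
  unfold parity
  rw [h, h y, h2, Function.update_self]
  generalize ∑ j ∈ Finset.univ.erase k, (if y j then 1 else 0 : ZMod 2) = c
  cases y k <;> revert c <;> decide

lemma muxParity_congr (blk : J → Fin B) (e : Fin n ≃ (J × Fin w) ⊕ (Fin B × Fin b))
    {z z' : Fin n → Bool} (hx : select blk (xPart e z') = select blk (xPart e z))
    (hy : yPart e z' = yPart e z) : muxParity blk e z' = muxParity blk e z := by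
  unfold muxParity
  rw [hx, hy]

lemma xPart_update_data (e : Fin n ≃ (J × Fin w) ⊕ (Fin B × Fin b)) (z : Fin n → Bool)
    (k : Fin B × Fin b) (v : Bool) :
    xPart e (Function.update z (e.symm (.inr k)) v) = xPart e z := by
  funext j t
  simp [xPart]

lemma yPart_update_data (e : Fin n ≃ (J × Fin w) ⊕ (Fin B × Fin b)) (z : Fin n → Bool)
    (k : Fin B × Fin b) (v : Bool) :
    yPart e (Function.update z (e.symm (.inr k)) v) = Function.update (yPart e z) k v := by
  funext j
  simp [yPart, Function.update_apply]

lemma muxParity_update_data (blk : J → Fin B) (e : Fin n ≃ (J × Fin w) ⊕ (Fin B × Fin b))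
    {z : Fin n → Bool} {β : Fin B} (h : select blk (xPart e z) = some β) (k : Fin b) :
    muxParity blk e (Function.update z (e.symm (.inr (β, k))) (!z (e.symm (.inr (β, k))))) =
      !muxParity blk e z := by
  simp only [muxParity, xPart_update_data, h, yPart_update_data]
  rw [← parity_update _ k]
  congr 1
  funext j
  simp [Function.update_apply, yPart]

lemma xPart_override {e : Fin n ≃ (J × Fin w) ⊕ (Fin B × Fin b)} {π : List (Fin n × Bool)}
    (hπ : DataOnly e π) (z : Fin n → Bool) : xPart e (override π z) = xPart e z := by
  funext j t
  refine override_of_notMem (fun p hp h => ?_) z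
  obtain ⟨k, hk⟩ := hπ p hp
  simp [hk] at h

lemma select_update_address [DecidableEq J] (blk : J → Fin B)
    (e : Fin n ≃ (J × Fin w) ⊕ (Fin B × Fin b)) (z : Fin n → Bool) (j : J) (t : Fin w)
    (h : ∃ t', t' ≠ t ∧ xPart e z j t' = false) (v : Bool) :
    select blk (xPart e (Function.update z (e.symm (.inl (j, t))) v)) =
      select blk (xPart e z) := by
  obtain ⟨t', ht, hf⟩ := h
  refine select_congr blk fun i => ?_
  by_cases hi : i = j
  · subst hi
    refine iff_of_false (fun h => ?_) fun h => ?_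
    · have := congrFun h t'
      simp only [xPart, allTrue, Function.update_apply] at this hf
      simp [ht, hf] at this
    · simp [h, allTrue] at hf
  · have : xPart e (Function.update z (e.symm (.inl (j, t))) v) i = xPart e z i := by
      funext s
      simp [xPart, hi]
    rw [this]

lemma yPart_update_address (e : Fin n ≃ (J × Fin w) ⊕ (Fin B × Fin b)) (z : Fin n → Bool)
    (q : J × Fin w) (v : Bool) :
    yPart e (Function.update z (e.symm (.inl q)) v) = yPart e z := by
  funext k
  simp [yPart]

lemma exists_data_notMem (e : Fin n ≃ (J × Fin w) ⊕ (Fin B × Fin b)) {π : List (Fin n × Bool)}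
    (h : π.length < B * b) : ∃ k, ∀ p ∈ π, p.1 ≠ e.symm (.inr k) := by
  by_contra! hcon
  have hsub : (Finset.univ.image fun k : Fin B × Fin b => e.symm (.inr k)) ⊆
      (π.map Prod.fst).toFinset := by
    intro i hi
    obtain ⟨k, -, rfl⟩ := Finset.mem_image.1 hi
    obtain ⟨p, hp, hpk⟩ := hcon k
    simp only [List.mem_toFinset, List.mem_map]
    exact ⟨p, hp, hpk⟩
  have h1 := Finset.card_le_card hsub
  rw [Finset.card_image_of_injective _
    (show Function.Injective fun k => e.symm (.inr k) from
      e.symm.injective.comp Sum.inr_injective)] at h1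
  have h2 := List.toFinset_card_le (π.map Prod.fst)
  simp at h1 h2
  omega

/-- The blocks all of whose variables occur in `π`. -/
def exhausted (e : Fin n ≃ (J × Fin w) ⊕ (Fin B × Fin b)) (π : List (Fin n × Bool)) :
    Finset (Fin B) :=
  Finset.univ.filter fun β => ∀ k, e.symm (.inr (β, k)) ∈ π.map Prod.fst

lemma card_exhausted_mul_le (e : Fin n ≃ (J × Fin w) ⊕ (Fin B × Fin b))
    (π : List (Fin n × Bool)) : (exhausted e π).card * b ≤ π.length := by
  have hsub : ((exhausted e π) ×ˢ (Finset.univ : Finset (Fin b))).image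
      (fun k => e.symm (.inr k)) ⊆ (π.map Prod.fst).toFinset := by
    intro i hi
    obtain ⟨⟨β, k⟩, hk, rfl⟩ := Finset.mem_image.1 hi
    simp only [Finset.mem_product, exhausted, Finset.mem_filter] at hk
    exact List.mem_toFinset.2 (hk.1.2 k)
  have h1 := Finset.card_le_card hsub
  rw [Finset.card_image_of_injective _
    (show Function.Injective fun k => e.symm (.inr k) from
      e.symm.injective.comp Sum.inr_injective)] at h1
  have h2 := List.toFinset_card_le (π.map Prod.fst)
  simp at h1 h2
  omega

lemma optSize_muxParity_le [Fintype J] (blk : J → Fin B) (e : Fin n ≃ (J × Fin w) ⊕ (Fin B × Fin b)) :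
    optSize (muxParity blk e) ≤ 2 ^ (Fintype.card J * w + b) := by
  classical
  set LX : List (Fin n) :=
    (Finset.univ : Finset (J × Fin w)).toList.map fun q => e.symm (.inl q) with hLX
  set LY : Fin B → List (Fin n) := fun β =>
    (List.finRange b).map fun k => e.symm (.inr (β, k)) with hLY
  have hG : ∀ x : Fin n → Bool, ∃ T : DecTree n, T.size ≤ 2 ^ b ∧
      ∀ z, select blk (xPart e z) = select blk (xPart e x) → T.eval z = muxParity blk e z := by
    intro x
    rcases h : select blk (xPart e x) with _ | β
    · exact ⟨.leaf false, Nat.one_le_two_pow, fun z hz => by simp [DecTree.eval, muxParity, hz]⟩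
    · obtain ⟨T, hs, hT⟩ := DecTree.exists_query_list (LY β)
        (fun z => .leaf (parity fun k => yPart e z (β, k))) (M := 1) fun z => le_rfl
      refine ⟨T, by simpa [hLY] using hs, fun z hz => ?_⟩
      rw [hT]
      simp only [DecTree.eval, muxParity, hz]
      congr 1
      funext k
      simp [yPart, hLY]
  choose G hGs hG using hG
  obtain ⟨T, hs, hT⟩ := DecTree.exists_query_list LX G hGs
  have hx : ∀ x : Fin n → Bool,
      xPart e (fun i => if i ∈ LX then x i else false) = xPart e x := by
    intro x
    funext j t
    simp [xPart, hLX]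
  refine (DecTree.optSize_le (T := T) fun x => ?_).trans (hs.trans_eq ?_)
  · rw [hT, hG _ _ (by rw [hx])]
  · rw [pow_add]
    simp [hLX]

lemma lt_optSize_muxParity [DecidableEq J] (blk : J → Fin B) (hblk : Function.Surjective blk) (hw : 0 < w)
    (e : Fin n ≃ (J × Fin w) ⊕ (Fin B × Fin b)) : B * b < optSize (muxParity blk e) := by
  obtain ⟨T, hT, hs⟩ := DecTree.exists_size_eq_optSize (muxParity blk e)
  rw [← hs]
  refine lt_of_le_of_lt ?_ T.card_vars_lt_size
  have hsub : (Finset.univ.image fun k : Fin B × Fin b => e.symm (.inr k)) ⊆ T.vars := by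
    intro i hi
    obtain ⟨⟨β, k⟩, -, rfl⟩ := Finset.mem_image.1 hi
    by_contra hcon
    obtain ⟨j, rfl⟩ := hblk β
    set x : J → Fin w → Bool := fun j' _ => decide (j' = j) with hx
    set z := (splitEquiv e).symm (x, fun _ => false) with hz
    have hxz : xPart e z = x := congrArg Prod.fst ((splitEquiv e).apply_symm_apply _)
    have hsel : select blk (xPart e z) = some (blk j) := by
      rw [hxz]
      refine select_eq_of_unique (by funext; simp [hx, allTrue]) fun j' hj' h => ?_
      have := congrFun h ⟨0, hw⟩
      simp [hx, allTrue, hj'] at this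
    have h1 := muxParity_update_data blk e hsel k
    rw [← hT, ← hT, T.eval_update hcon] at h1
    simp at h1
  have h1 := Finset.card_le_card hsub
  rw [Finset.card_image_of_injective _
    (show Function.Injective fun k => e.symm (.inr k) from
      e.symm.injective.comp Sum.inr_injective)] at h1
  simpa using h1

variable [Fintype J] [DecidableEq J]

lemma two_pow_eq (e : Fin n ≃ (J × Fin w) ⊕ (Fin B × Fin b)) :
    2 ^ n = (2 ^ w) ^ Fintype.card J * 2 ^ (B * b) := by
  have := Fintype.card_congr (splitEquiv e)
  simpa using this

lemma card_filter_split (e : Fin n ≃ (J × Fin w) ⊕ (Fin B × Fin b))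
    (Q : (J → Fin w → Bool) → (Fin B × Fin b → Bool) → Prop) [∀ x y, Decidable (Q x y)] :
    (Finset.univ.filter fun z : Fin n → Bool => Q (xPart e z) (yPart e z)).card =
      ∑ y, (Finset.univ.filter fun x => Q x y).card := by
  rw [Finset.card_filter]
  simp_rw [Finset.card_filter]
  rw [← Fintype.sum_prod_type_right' (f := fun x y => if Q x y then 1 else 0)]
  exact Fintype.sum_equiv (splitEquiv e) _ _ fun z => rfl

lemma card_filter_xPart (e : Fin n ≃ (J × Fin w) ⊕ (Fin B × Fin b))
    (P : (J → Fin w → Bool) → Prop) [DecidablePred P] :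
    (Finset.univ.filter fun z : Fin n → Bool => P (xPart e z)).card =
      (Finset.univ.filter P).card * 2 ^ (B * b) := by
  rw [card_filter_split e fun x _ => P x]
  simp [mul_comm]

lemma influence_address_le (blk : J → Fin B) (e : Fin n ≃ (J × Fin w) ⊕ (Fin B × Fin b))
    {π : List (Fin n × Bool)} (hπ : DataOnly e π) (q : J × Fin w) :
    influence (restrictList (muxParity blk e) π) (e.symm (.inl q)) ≤
      ((2 * (2 ^ w) ^ (Fintype.card J - 1) * 2 ^ (B * b) : ℕ) : ℝ) / 2 ^ n := by
  obtain ⟨j, t⟩ := q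
  unfold influence
  rw [Fintype.card_fin]
  gcongr
  set S : Finset (Fin w → Bool) := {allTrue w, Function.update (allTrue w) t false}
  calc _ ≤ (Finset.univ.filter fun z : Fin n → Bool => xPart e z j ∈ S).card := by
        refine Finset.card_le_card fun z hz => ?_
        refine Finset.mem_filter.2 ⟨Finset.mem_univ _, ?_⟩
        by_contra hS
        refine (Finset.mem_filter.1 hz).2 ?_
        unfold restrictList
        rw [override_update]
        · refine (muxParity_congr blk e (select_update_address blk e _ j t ?_ _)
            (yPart_update_address e _ _ _)).symm
          rw [xPart_override hπ]
          by_contra! hall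
          refine hS ?_
          simp only [S, Finset.mem_insert, Finset.mem_singleton]
          rcases ht : xPart e z j t with _ | _
          · right
            funext s
            by_cases hs : s = t
            · subst hs; simp [ht]
            · simpa [hs, allTrue] using hall s hs
          · left
            funext s
            by_cases hs : s = t
            · subst hs; simp [ht, allTrue]
            · simpa [hs, allTrue] using hall s hs
        · rintro p hp h
          obtain ⟨k, hk⟩ := hπ p hp
          simp [hk] at h
    _ = S.card * (2 ^ w) ^ (Fintype.card J - 1) * 2 ^ (B * b) := by
        rw [card_filter_xPart e fun x => x j ∈ S, card_filter_apply_mem]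
    _ ≤ _ := by
        gcongr
        exact Finset.card_le_two

lemma le_influence_data (blk : J → Fin B) (e : Fin n ≃ (J × Fin w) ⊕ (Fin B × Fin b)) {C : ℕ}
    (hC : ∀ β, (Finset.univ.filter fun j => blk j = β).card = C)
    {π : List (Fin n × Bool)} (hπ : DataOnly e π) {k : Fin B × Fin b}
    (hk : ∀ p ∈ π, p.1 ≠ e.symm (.inr k)) :
    ((C * (2 ^ w - 1) ^ (Fintype.card J - 1) * 2 ^ (B * b) : ℕ) : ℝ) / 2 ^ n ≤
      influence (restrictList (muxParity blk e) π) (e.symm (.inr k)) := by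
  obtain ⟨β, k⟩ := k
  unfold influence
  rw [Fintype.card_fin]
  gcongr
  calc _ ≤ (Finset.univ.filter fun x : J → Fin w → Bool => select blk x = some β).card *
          2 ^ (B * b) := by
        gcongr
        exact le_card_filter_select_eq blk β (hC β).ge
    _ = (Finset.univ.filter fun z : Fin n → Bool => select blk (xPart e z) = some β).card :=
        (card_filter_xPart e fun x => select blk x = some β).symm
    _ ≤ _ := by
        refine Finset.card_le_card fun z hz => ?_
        replace hz := (Finset.mem_filter.1 hz).2
        refine Finset.mem_filter.2 ⟨Finset.mem_univ _, ?_⟩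
        unfold restrictList
        rw [override_update hk]
        have h := muxParity_update_data blk e (z := override π z) (by rwa [xPart_override hπ]) k
        rw [override_of_notMem hk] at h
        rw [h]
        simp

lemma lt_completionErr (blk : J → Fin B) (e : Fin n ≃ (J × Fin w) ⊕ (Fin B × Fin b))
    {C u : ℕ} {ε : ℝ} (hC : ∀ β, (Finset.univ.filter fun j => blk j = β).card = C) (hb : 0 < b)
    (herr : (((2 ^ w - 1) ^ Fintype.card J + u * C * (2 ^ w) ^ (Fintype.card J - 1) : ℕ) : ℝ) <
      (1 - 2 * ε) * (2 ^ w) ^ Fintype.card J)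
    {T : BareTree n} (hT : ∀ π ∈ T.leafPaths, π.length ≤ u * b ∧ DataOnly e π) :
    ε < completionErr (muxParity blk e) T := by
  set f := muxParity blk e with hf
  have hF : ∀ (β : Fin B) (π : List (Fin n × Bool)), ∃ k : Fin b,
      β ∉ exhausted e π → ∀ p ∈ π, p.1 ≠ e.symm (.inr (β, k)) := by
    intro β π
    by_cases h : β ∈ exhausted e π
    · exact ⟨⟨0, hb⟩, fun h' => absurd h h'⟩
    · simp only [exhausted, Finset.mem_filter, Finset.mem_univ, true_and, not_forall] at h
      obtain ⟨k, hk⟩ := h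
      exact ⟨k, fun _ p hp hpk => hk (hpk ▸ List.mem_map_of_mem hp)⟩
  choose F hF using hF
  set φ : (Fin n → Bool) → Fin n → Bool := fun z =>
    match select blk (xPart e z) with
    | none => z
    | some β => Function.update z (e.symm (.inr (β, F β (T.path z))))
        (!z (e.symm (.inr (β, F β (T.path z))))) with hφ
  have hφ_eq : ∀ z β, select blk (xPart e z) = some β →
      φ z = Function.update z (e.symm (.inr (β, F β (T.path z))))
        (!z (e.symm (.inr (β, F β (T.path z))))) := fun z β h => by simp [hφ, h]
  have hφ_sel : ∀ z β, select blk (xPart e z) = some β → select blk (xPart e (φ z)) = some β :=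
    fun z β h => by rw [hφ_eq z β h, xPart_update_data, h]
  have hφ_path : ∀ z β, select blk (xPart e z) = some β → β ∉ exhausted e (T.path z) →
      T.path (φ z) = T.path z := fun z β h hβ => by
    refine T.path_congr fun p hp => ?_
    rw [hφ_eq z β h, Function.update_of_ne (hF _ _ hβ p hp)]
  have hφ_f : ∀ z β, select blk (xPart e z) = some β → f (φ z) = !f z := fun z β h => by
    rw [hφ_eq z β h]
    exact muxParity_update_data blk e h _
  set good : Finset (Fin n → Bool) := Finset.univ.filter fun z =>
    ∃ β, select blk (xPart e z) = some β ∧ β ∉ exhausted e (T.path z) with hgood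
  set err : Finset (Fin n → Bool) := Finset.univ.filter fun z =>
    f z ≠ (completion f T).eval z with herrs
  have hgood_le : good.card ≤ 2 * err.card := by
    have h1 : (good \ err).card ≤ err.card := by
      refine Finset.card_le_card_of_injOn φ (fun z hz => ?_) fun z hz z' hz' hzz => ?_
      · simp only [hgood, herrs, Finset.coe_sdiff, Set.mem_sdiff, Finset.coe_filter,
          Finset.mem_univ, true_and, Set.mem_ofPred_eq, not_not, ne_eq] at hz ⊢
        obtain ⟨⟨β, h, hβ⟩, hz⟩ := hz
        rw [hφ_f z β h, hz, completion,
          completionAux_eval_congr f T [] (hφ_path z β h hβ)]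
        simp
      · simp only [hgood, Finset.coe_sdiff, Set.mem_sdiff, Finset.coe_filter, Finset.mem_univ,
          true_and, Set.mem_ofPred_eq] at hz hz'
        obtain ⟨⟨β, h, hβ⟩, -⟩ := hz
        obtain ⟨⟨β', h', hβ'⟩, -⟩ := hz'
        have hs := hφ_sel z β h
        rw [hzz, hφ_sel z' β' h'] at hs
        obtain rfl : β' = β := by simpa using hs
        have hp := hφ_path z β' h hβ
        rw [hzz, hφ_path z' β' h' hβ'] at hp
        rw [hφ_eq z β' h, hφ_eq z' β' h', hp] at hzz
        funext i
        have := congrFun hzz i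
        by_cases hi : i = e.symm (.inr (β', F β' (T.path z)))
        · rw [← hi] at this
          simpa using this
        · simpa [Function.update_of_ne hi] using this
    have h2 := Finset.card_sdiff_add_card good err
    have h3 := Finset.card_le_card (Finset.subset_union_left (s₁ := good) (s₂ := err))
    omega
  set E : (Fin B × Fin b → Bool) → Finset (Fin B) := fun y =>
    exhausted e (T.path ((splitEquiv e).symm (fun _ _ => false, y))) with hE
  have hE_path : ∀ z, exhausted e (T.path z) = E (yPart e z) := fun z => by
    simp only [hE]
    congr 1
    refine (T.path_congr fun p hp => ?_).symm
    obtain ⟨k, hk⟩ := (hT _ (T.path_mem_leafPaths z)).2 p hp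
    rw [hk]
    simp [splitEquiv, yPart]
  have hE_card : ∀ y, (E y).card ≤ u := fun y => by
    have h1 := card_exhausted_mul_le e (T.path ((splitEquiv e).symm (fun _ _ => false, y)))
    have h2 := (hT _ (T.path_mem_leafPaths ((splitEquiv e).symm (fun _ _ => false, y)))).1
    exact Nat.le_of_mul_le_mul_right (h1.trans h2) hb
  have hbad : goodᶜ.card ≤
      ((2 ^ w - 1) ^ Fintype.card J + u * C * (2 ^ w) ^ (Fintype.card J - 1)) * 2 ^ (B * b) := by
    have hsub : goodᶜ ⊆ Finset.univ.filter fun z : Fin n → Bool =>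
        select blk (xPart e z) = none ∨
          ∃ β ∈ E (yPart e z), select blk (xPart e z) = some β := by
      intro z hz
      simp only [hgood, Finset.mem_compl, Finset.mem_filter, Finset.mem_univ, true_and,
        not_exists, not_and, not_not] at hz ⊢
      rcases h : select blk (xPart e z) with _ | β
      · exact Or.inl rfl
      · exact Or.inr ⟨β, hE_path z ▸ hz β h, rfl⟩
    refine (Finset.card_le_card hsub).trans ?_
    rw [card_filter_split e fun x y => select blk x = none ∨ ∃ β ∈ E y, select blk x = some β]
    refine (Finset.sum_le_card_nsmul _ _
      ((2 ^ w - 1) ^ Fintype.card J + u * C * (2 ^ w) ^ (Fintype.card J - 1))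
      fun y _ => ?_).trans ?_
    · rw [Finset.filter_or]
      refine (Finset.card_union_le _ _).trans (add_le_add (card_filter_select_none_le blk) ?_)
      refine (card_filter_select_mem_le blk (fun β => (hC β).le) (E y)).trans ?_
      gcongr
      exact hE_card y
    · simp [mul_comm]
  have htot : good.card + goodᶜ.card = 2 ^ n := by
    rw [Finset.card_add_card_compl]
    simp
  have hn := two_pow_eq e
  have key : (2 : ℝ) ^ n < 2 * err.card + (1 - 2 * ε) * 2 ^ n := by
    have h1 : ((2 ^ n : ℕ) : ℝ) ≤ 2 * err.card +
        (((2 ^ w - 1) ^ Fintype.card J + u * C * (2 ^ w) ^ (Fintype.card J - 1) : ℕ) : ℝ) *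
          2 ^ (B * b) := by
      have : 2 ^ n ≤ 2 * err.card +
          ((2 ^ w - 1) ^ Fintype.card J + u * C * (2 ^ w) ^ (Fintype.card J - 1)) *
            2 ^ (B * b) := by omega
      exact_mod_cast this
    have h2 : (2 : ℝ) ^ n = (2 ^ w) ^ Fintype.card J * 2 ^ (B * b) := by exact_mod_cast hn
    have h3 := mul_lt_mul_of_pos_right herr (by positivity : (0 : ℝ) < 2 ^ (B * b))
    rw [mul_assoc (1 - 2 * ε), ← h2] at h3
    push_cast at h1 h3
    linarith
  unfold completionErr errf
  rw [lt_div_iff₀ (by positivity)]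
  linarith

/-- The top-down heuristic queries only data variables until it reaches depth `u * b`, by which
time the whole tree is almost complete to that depth. -/
lemma two_pow_le_size_of_isRun (blk : J → Fin B) (e : Fin n ≃ (J × Fin w) ⊕ (Fin B × Fin b))
    {C u : ℕ} {ε : ℝ} (hC : ∀ β, (Finset.univ.filter fun j => blk j = β).card = C) (hb : 0 < b)
    (huB : u < B)
    (hinf : 2 * (2 ^ w) ^ (Fintype.card J - 1) < C * (2 ^ w - 1) ^ (Fintype.card J - 1))
    (herr : (((2 ^ w - 1) ^ Fintype.card J + u * C * (2 ^ w) ^ (Fintype.card J - 1) : ℕ) : ℝ) <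
      (1 - 2 * ε) * (2 ^ w) ^ Fintype.card J)
    {m : ℕ} {g : ℕ → BareTree n} (hg : IsRun (muxParity blk e) ε m g)
    (hm : completionErr (muxParity blk e) (g m) ≤ ε) :
    2 ^ (u * b - w) ≤ (g m).size := by
  set f := muxParity blk e with hf
  set Inv : BareTree n → Prop := fun T => ∀ π ∈ T.leafPaths, π.length ≤ u * b ∧ DataOnly e π
    with hInv
  have hlt : u * b < B * b := Nat.mul_lt_mul_of_pos_right huB hb
  have h0 : Inv (g 0) := by
    rw [hg.1]
    intro π hπ
    simp only [BareTree.leafPaths, List.mem_singleton] at hπ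
    subst hπ
    exact ⟨Nat.zero_le _, fun p hp => by simp at hp⟩
  have hlast : ¬ Inv (g m) := fun h => absurd hm
    (not_le.2 (lt_completionErr blk e hC hb herr h))
  obtain ⟨j, hjm, hj, hj1⟩ : ∃ j < m, Inv (g j) ∧ ¬ Inv (g (j + 1)) := by
    by_contra! hcon
    have : ∀ j ≤ m, Inv (g j) := by
      intro j
      induction j with
      | zero => exact fun _ => h0
      | succ j ih => exact fun hj => hcon j (by omega) (ih (by omega))
    exact hlast (this m le_rfl)
  refine le_trans ?_ (size_le_of_isRun hg hjm.le)
  obtain ⟨π, hπ, i, hmax, hi, heq⟩ := (hg.2 j hjm).2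
  have hpq : ((2 * (2 ^ w) ^ (Fintype.card J - 1) * 2 ^ (B * b) : ℕ) : ℝ) / 2 ^ n <
      ((C * (2 ^ w - 1) ^ (Fintype.card J - 1) * 2 ^ (B * b) : ℕ) : ℝ) / 2 ^ n := by
    gcongr
  have hdata : ∃ k, i = e.symm (.inr k) := by
    rcases hq : e i with q | k
    · exfalso
      obtain rfl : i = e.symm (.inl q) := by rw [← hq, e.symm_apply_apply]
      obtain ⟨k, hk⟩ := exists_data_notMem e ((hj π hπ).1.trans_lt hlt)
      have h1 := le_influence_data blk e hC (hj π hπ).2 hk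
      have h2 := influence_address_le blk e (hj π hπ).2 q
      have h3 := hi (e.symm (.inr k))
      linarith
    · exact ⟨k, by rw [← hq, e.symm_apply_apply]⟩
  have hlen : u * b ≤ π.length := by
    by_contra! hcon
    refine hj1 fun ρ hρ => ?_
    rw [heq] at hρ
    rcases BareTree.mem_leafPaths_replaceLeaf _ hπ hρ with h | ⟨v, rfl⟩
    · exact hj ρ h
    · refine ⟨by simpa using hcon, fun p hp => ?_⟩
      rcases List.mem_append.1 hp with hp | hp
      · exact (hj π hπ).2 p hp
      · rw [List.mem_singleton.1 hp]
        exact hdata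
  refine BareTree.two_pow_le_size _ fun ρ hρ => ?_
  obtain ⟨k, hk⟩ := exists_data_notMem e ((hj ρ hρ).1.trans_lt hlt)
  have h1 := le_influence_data blk e hC (hj ρ hρ).2 hk
  have h2 := le_leafScore f ρ (e.symm (.inr k))
  have h3 := (hmax ρ hρ).trans (leafScore_le f π)
  have h4 : ((1 : ℝ) / 2) ^ w ≤
      ((2 * (2 ^ w) ^ (Fintype.card J - 1) * 2 ^ (B * b) : ℕ) : ℝ) / 2 ^ n := by
    have h5 : (2 : ℝ) ^ n = (2 ^ w) ^ Fintype.card J * 2 ^ (B * b) := by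
      exact_mod_cast two_pow_eq e
    have h6 : ((2 : ℝ) ^ w) ^ Fintype.card J ≤
        2 ^ w * (2 * (2 ^ w) ^ (Fintype.card J - 1)) := by
      rcases Nat.eq_zero_or_pos (Fintype.card J) with h | h
      · rw [h]
        have : (1 : ℝ) ≤ 2 ^ w := one_le_pow₀ (by norm_num)
        simp only [pow_zero, zero_tsub, mul_one]
        linarith
      · obtain ⟨N, hN⟩ := Nat.exists_eq_succ_of_ne_zero h.ne'
        rw [hN, Nat.succ_eq_add_one, Nat.add_sub_cancel, pow_succ]
        have : (0 : ℝ) < (2 ^ w) ^ N * 2 ^ w := by positivity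
        linarith
    rw [le_div_iff₀ (by positivity), h5, one_div, inv_pow, inv_mul_le_iff₀ (by positivity)]
    push_cast
    rw [← mul_assoc ((2 : ℝ) ^ w)]
    exact mul_le_mul_of_nonneg_right h6 (by positivity)
  have h7 : ((1 : ℝ) / 2) ^ (ρ.length + w) ≤ (1 / 2) ^ π.length := by
    rw [pow_add]
    refine le_trans (mul_le_mul_of_nonneg_left (h4.trans (hpq.le.trans h1)) (by positivity)) ?_
    exact h2.trans h3
  have h8 := (pow_le_pow_iff_right_of_lt_one₀ (by norm_num) (by norm_num)).1 h7
  omega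

end Mux

/-! ### Numerical estimates -/

section Estimates

lemma one_div_four_le_one_sub_pow {w : ℕ} (hw : 1 ≤ w) :
    (1 / 4 : ℝ) ≤ (1 - 1 / 2 ^ w) ^ 2 ^ w := by
  induction w, hw using Nat.le_induction with
  | base => norm_num
  | succ w hw ih =>
    have h2 : (1 : ℝ) / 2 ^ w ≤ 1 := by
      rw [div_le_one (by positivity)]
      exact one_le_pow₀ (by norm_num)
    refine ih.trans ?_
    rw [show (2 : ℕ) ^ (w + 1) = 2 * 2 ^ w by ring, pow_mul _ 2]
    refine pow_le_pow_left₀ (by linarith) ?_ _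
    have : (1 : ℝ) / 2 ^ (w + 1) = 1 / 2 ^ w / 2 := by rw [pow_succ]; field_simp
    rw [this]
    nlinarith [sq_nonneg ((1 : ℝ) / 2 ^ w)]

lemma one_sub_pow_le (w : ℕ) : (1 - 1 / 2 ^ w : ℝ) ^ 2 ^ w ≤ 1 / 2 := by
  have h : (1 - 1 / ((2 ^ w : ℕ) : ℝ)) ^ 2 ^ w ≤ Real.exp (-1) :=
    Real.one_sub_div_pow_le_exp_neg (by exact_mod_cast Nat.one_le_two_pow)
  push_cast at h
  refine h.trans ?_
  rw [Real.exp_neg, inv_le_comm₀ (Real.exp_pos _) (by norm_num)]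
  have := Real.add_one_le_exp (1 : ℝ)
  norm_num at this ⊢
  exact this

lemma cast_two_pow_sub_one (w : ℕ) : ((2 ^ w - 1 : ℕ) : ℝ) = (1 - 1 / 2 ^ w) * 2 ^ w := by
  rw [Nat.cast_sub Nat.one_le_two_pow]
  push_cast
  field_simp

lemma influence_gap {a w N : ℕ} (hw : 1 ≤ w) (hN : N = a * 2 ^ w) :
    2 * (2 ^ w) ^ (N - 1) < 4 ^ (a + 1) * (2 ^ w - 1) ^ (N - 1) := by
  have h0 : (0 : ℝ) ≤ 1 - 1 / 2 ^ w := by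
    rw [sub_nonneg, div_le_one (by positivity)]
    exact one_le_pow₀ (by norm_num)
  have h1 : (1 - 1 / 2 ^ w : ℝ) ≤ 1 := by
    have : (0 : ℝ) ≤ 1 / 2 ^ w := by positivity
    linarith
  have h2 : (1 / 4 : ℝ) ^ a ≤ (1 - 1 / 2 ^ w) ^ (N - 1) := by
    calc (1 / 4 : ℝ) ^ a ≤ ((1 - 1 / 2 ^ w) ^ 2 ^ w) ^ a :=
          pow_le_pow_left₀ (by norm_num) (one_div_four_le_one_sub_pow hw) _
      _ = (1 - 1 / 2 ^ w) ^ N := by rw [← pow_mul, hN, mul_comm]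
      _ ≤ _ := pow_le_pow_of_le_one h0 h1 (Nat.sub_le _ _)
  have h3 : (4 : ℝ) ≤ 4 ^ (a + 1) * (1 - 1 / 2 ^ w) ^ (N - 1) := by
    calc (4 : ℝ) = 4 ^ (a + 1) * (1 / 4) ^ a := by
          rw [pow_succ, one_div, inv_pow]; field_simp
      _ ≤ _ := by gcongr
  have h4 : ((2 * (2 ^ w) ^ (N - 1) : ℕ) : ℝ) <
      ((4 ^ (a + 1) * (2 ^ w - 1) ^ (N - 1) : ℕ) : ℝ) := by
    rw [Nat.cast_mul, Nat.cast_mul, Nat.cast_pow (2 ^ w - 1), cast_two_pow_sub_one, mul_pow]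
    push_cast
    rw [← mul_assoc]
    exact mul_lt_mul_of_pos_right (by linarith) (by positivity)
  exact_mod_cast h4

lemma error_gap {ε : ℝ} {a u N : ℕ} (ha : 1 ≤ a) (hε : 2 * (1 / 2 : ℝ) ^ a < 1 - 2 * ε)
    (hN : N = a * 2 ^ (u + 3 * a + 2)) :
    (((2 ^ (u + 3 * a + 2) - 1) ^ N +
      2 ^ u * 4 ^ (a + 1) * (2 ^ (u + 3 * a + 2)) ^ (N - 1) : ℕ) : ℝ) <
      (1 - 2 * ε) * (2 ^ (u + 3 * a + 2)) ^ N := by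
  obtain ⟨M, rfl⟩ : ∃ M, N = M + 1 := Nat.exists_eq_succ_of_ne_zero (by
    rw [hN]; positivity)
  have h1 : ((2 ^ u * 4 ^ (a + 1) : ℕ) : ℝ) = (1 / 2) ^ a * 2 ^ (u + 3 * a + 2) := by
    have : (4 : ℝ) = 2 ^ 2 := by norm_num
    push_cast
    rw [this, ← pow_mul, ← pow_add, show u + 3 * a + 2 = a + (u + 2 * (a + 1)) by ring,
      pow_add 2 a, ← mul_assoc, ← mul_pow]
    norm_num
  set w := u + 3 * a + 2
  have h0 : (0 : ℝ) ≤ 1 - 1 / 2 ^ w := by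
    rw [sub_nonneg, div_le_one (by positivity)]
    exact one_le_pow₀ (by norm_num)
  have h2 : (1 - 1 / 2 ^ w : ℝ) ^ (M + 1) ≤ (1 / 2) ^ a := by
    rw [hN, mul_comm, pow_mul]
    exact pow_le_pow_left₀ (by positivity) (one_sub_pow_le w) _
  rw [Nat.cast_add, Nat.cast_mul, h1, Nat.cast_pow, cast_two_pow_sub_one, mul_pow,
    Nat.add_sub_cancel]
  push_cast
  have h3 : (0 : ℝ) < (2 ^ w) ^ (M + 1) := by positivity
  calc (1 - 1 / 2 ^ w : ℝ) ^ (M + 1) * (2 ^ w) ^ (M + 1) + (1 / 2) ^ a * 2 ^ w * (2 ^ w) ^ M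
      ≤ (1 / 2) ^ a * (2 ^ w) ^ (M + 1) + (1 / 2) ^ a * 2 ^ w * (2 ^ w) ^ M := by gcongr
    _ = (2 * (1 / 2) ^ a) * (2 ^ w) ^ (M + 1) := by ring
    _ < _ := mul_lt_mul_of_pos_right hε h3

lemma sq_div_logb_cube_le {a w : ℕ} (ha : 1 ≤ a) {L : ℝ} (hL : 2 ≤ L)
    (hLw : L ≤ 2 * a * w * 2 ^ w) : L ^ 2 / Real.logb 2 L ^ 3 ≤ 32 * a ^ 2 * 4 ^ w := by
  have hlog : 1 ≤ Real.logb 2 L := by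
    rw [Real.le_logb_iff_rpow_le (by norm_num) (by linarith)]
    simpa using hL
  have ha' : (1 : ℝ) ≤ a := by exact_mod_cast ha
  have h4 : (4 : ℝ) ^ w = 2 ^ w * 2 ^ w := by rw [← mul_pow]; norm_num
  have h2w : (1 : ℝ) ≤ 2 ^ w := one_le_pow₀ (by norm_num)
  rw [div_le_iff₀ (by positivity)]
  rcases lt_or_ge (Real.logb 2 L) (w / 2) with h | h
  · have hL2 : L ^ 2 ≤ 2 ^ w := by
      have : L = 2 ^ Real.logb 2 L := (Real.rpow_logb (by norm_num) (by norm_num)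
        (by linarith)).symm
      rw [this, ← Real.rpow_natCast, ← Real.rpow_mul (by norm_num), ← Real.rpow_natCast 2 w]
      refine Real.rpow_le_rpow_of_exponent_le (by norm_num) ?_
      push_cast
      linarith
    have h3 : (1 : ℝ) ≤ Real.logb 2 L ^ 3 := one_le_pow₀ hlog
    have ha2 : (1 : ℝ) ≤ a ^ 2 := one_le_pow₀ ha'
    calc L ^ 2 ≤ 2 ^ w := hL2
      _ ≤ 4 ^ w := by rw [h4]; nlinarith
      _ ≤ 32 * a ^ 2 * 4 ^ w := le_mul_of_one_le_left (by positivity) (by linarith)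
      _ ≤ _ := le_mul_of_one_le_right (by positivity) h3
  · have hw : (1 : ℝ) ≤ w := by
      have : w ≠ 0 := by
        rintro rfl
        norm_num at hLw
        linarith
      exact_mod_cast Nat.one_le_iff_ne_zero.2 this
    calc L ^ 2 ≤ (2 * a * w * 2 ^ w : ℝ) ^ 2 := by gcongr
      _ = 4 * (a : ℝ) ^ 2 * (w : ℝ) ^ 2 * 4 ^ w := by rw [h4]; ring
      _ ≤ 4 * (a : ℝ) ^ 2 * (w : ℝ) ^ 2 * 4 ^ w * w := le_mul_of_one_le_right (by positivity) hw
      _ = 32 * (a : ℝ) ^ 2 * 4 ^ w * ((w : ℝ) / 2) ^ 3 := by ring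
      _ ≤ _ := by gcongr

end Estimates

end TopDownDT

/-- For every `ε ∈ (0, 1/2)` there is a constant `c > 0` (depending
only on `ε`) such that for infinitely many `n` there is a function
`f : {0,1}ⁿ → {±1}` of optimal decision tree size `s` with `s ≤ 2^{Õ(√n)}`
(the `Õ` hidden by a constant `C`), yet — regardless of how ties are broken —
every complete run of `BuildTopDownDT(f, ε)` outputs a tree of size at least
`s^{c·log₂(s)/(log₂ log₂ s)³}`, i.e. `TopDownDTSize(f, ε) ≥ s^{Ω̃(log s)}`. -/
theorem topDown_superpolynomial_lower_bound
    (ε : ℝ) (hε0 : 0 < ε) (hε1 : ε < 1 / 2) :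
    ∃ c : ℝ, 0 < c ∧ ∃ C : ℝ, 0 < C ∧
      {n : ℕ | ∃ f : (Fin n → Bool) → Bool, ∃ s : ℕ,
        optSize f = s ∧ 4 ≤ s ∧
        (s : ℝ) ≤ 2 ^ (C * Real.sqrt n * Real.logb 2 n ^ C) ∧
        ∀ (m : ℕ) (g : ℕ → BareTree n),
          IsRun f ε m g → completionErr f (g m) ≤ ε →
          (s : ℝ) ^ (c * Real.logb 2 s / Real.logb 2 (Real.logb 2 s) ^ 3) ≤
            ((g m).size : ℝ)}.Infinite := by
  obtain ⟨a', ha'⟩ := exists_pow_lt_of_lt_one (show 0 < 1 - 2 * ε by linarith)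
    (show (1 / 2 : ℝ) < 1 by norm_num)
  obtain ⟨a, ha1, ha⟩ : ∃ a : ℕ, 1 ≤ a ∧ 2 * (1 / 2 : ℝ) ^ a < 1 - 2 * ε :=
    ⟨a' + 1, by omega, by rw [pow_succ]; linarith⟩
  have haR : (1 : ℝ) ≤ a := by exact_mod_cast ha1
  refine ⟨1 / (2 ^ (3 * a + 3) * (32 * a ^ 2)), by positivity, 2 * a * 2 ^ (a + 1),
    by positivity, Set.infinite_of_forall_exists_gt fun u => ?_⟩
  obtain ⟨w, hw⟩ : ∃ w, w = u + 3 * a + 2 := ⟨_, rfl⟩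
  obtain ⟨B, hB⟩ : ∃ B, B = a * 2 ^ (u + a) := ⟨_, rfl⟩
  have hBC : B * 4 ^ (a + 1) = a * 2 ^ w := by
    rw [hB, hw, show 4 = 2 ^ 2 by norm_num, ← pow_mul, mul_assoc, ← pow_add]
    ring_nf
  have hJ : Fintype.card (Fin B × Fin (4 ^ (a + 1))) = a * 2 ^ w := by simpa using hBC
  obtain ⟨n, hn⟩ : ∃ n, n = a * 2 ^ w * w + B * 2 ^ w := ⟨_, rfl⟩
  have hcard : Fintype.card
      (((Fin B × Fin (4 ^ (a + 1))) × Fin w) ⊕ (Fin B × Fin (2 ^ w))) = n := by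
    rw [Fintype.card_sum, Fintype.card_prod, hJ, hn]
    simp
  let e := (Fintype.equivFinOfCardEq hcard).symm
  let blk : Fin B × Fin (4 ^ (a + 1)) → Fin B := Prod.fst
  have hC : ∀ β, (Finset.univ.filter fun j => blk j = β).card = 4 ^ (a + 1) := by
    intro β
    have : (Finset.univ.filter fun j => blk j = β) =
        ({β} : Finset (Fin B)) ×ˢ (Finset.univ : Finset (Fin (4 ^ (a + 1)))) := by
      ext j
      simp only [Finset.mem_filter, Finset.mem_univ, true_and, Finset.mem_product,
        Finset.mem_singleton, and_true, blk]
    rw [this, Finset.card_product]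
    simp
  have huB : 2 ^ u < B := by
    have h1 : 2 ^ u < 2 ^ (u + a) := Nat.pow_lt_pow_right (by norm_num) (by omega)
    rw [hB]
    nlinarith
  have hB0 : 0 < B := (Nat.zero_le _).trans_lt huB
  have hwn : 2 ^ w ≤ n := by
    have : 2 ^ w ≤ B * 2 ^ w := Nat.le_mul_of_pos_left _ hB0
    omega
  have hs_le := optSize_muxParity_le blk e
  rw [hJ] at hs_le
  have hs_ge : 4 ≤ optSize (muxParity blk e) := by
    have h1 := lt_optSize_muxParity blk
      (fun β => ⟨(β, ⟨0, by positivity⟩), rfl⟩) (by omega) e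
    have h2 : 2 ^ 2 ≤ 2 ^ w := Nat.pow_le_pow_right (by norm_num) (by omega)
    have : 2 ^ w ≤ B * 2 ^ w := Nat.le_mul_of_pos_left _ hB0
    omega
  obtain ⟨s, hs⟩ : ∃ s, s = optSize (muxParity blk e) := ⟨_, rfl⟩
  rw [← hs] at hs_le hs_ge
  have hs0 : (0 : ℝ) < s := by exact_mod_cast (show 0 < s by omega)
  have hs_le' : (s : ℝ) ≤ 2 ^ (2 * a * w * 2 ^ w : ℝ) := by
    have h1 : (s : ℝ) ≤ 2 ^ (a * 2 ^ w * w + 2 ^ w) := by exact_mod_cast hs_le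
    refine h1.trans ?_
    rw [← Real.rpow_natCast]
    refine Real.rpow_le_rpow_of_exponent_le (by norm_num) ?_
    push_cast
    have hw1 : (1 : ℝ) ≤ w := by exact_mod_cast (show 1 ≤ w by omega)
    have h2 : (1 : ℝ) ≤ a * w := one_le_mul_of_one_le_of_one_le haR hw1
    have h3 : (0 : ℝ) < 2 ^ w := by positivity
    nlinarith
  refine ⟨n, ⟨muxParity blk e, s, hs.symm, hs_ge, hs_le'.trans ?_, fun m g hg hm => ?_⟩, ?_⟩
  · refine Real.rpow_le_rpow_of_exponent_le (by norm_num) ?_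
    have hlog : (w : ℝ) ≤ Real.logb 2 n := by
      rw [Real.le_logb_iff_rpow_le (by norm_num)
        (by exact_mod_cast (Nat.two_pow_pos w).trans_le hwn), Real.rpow_natCast]
      exact_mod_cast hwn
    have hw1 : (1 : ℝ) ≤ w := by exact_mod_cast (show 1 ≤ w by omega)
    have hpow : (w : ℝ) ≤ Real.logb 2 n ^ (2 * a * 2 ^ (a + 1) : ℝ) := by
      refine hlog.trans ?_
      conv_lhs => rw [← Real.rpow_one (Real.logb 2 n)]
      refine Real.rpow_le_rpow_of_exponent_le (hw1.trans hlog) ?_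
      have : (1 : ℝ) ≤ 2 ^ (a + 1) := one_le_pow₀ (by norm_num)
      nlinarith
    have hsqrt : (2 : ℝ) ^ w ≤ 2 ^ (a + 1) * Real.sqrt n := by
      have h1 : (2 : ℝ) ^ w / 2 ^ (a + 1) ≤ Real.sqrt n := by
        refine Real.le_sqrt_of_sq_le ?_
        have h2 : (2 ^ w) ^ 2 ≤ (2 ^ (a + 1)) ^ 2 * n := by
          have h3 : (2 ^ w) ^ 2 ≤ (2 ^ (a + 1)) ^ 2 * (B * 2 ^ w) := by
            calc (2 ^ w) ^ 2 ≤ a * 2 ^ w * 2 ^ w := by nlinarith [Nat.two_pow_pos w]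
              _ = (2 ^ (a + 1)) ^ 2 * (B * 2 ^ w) := by
                rw [← hBC, show 4 = 2 ^ 2 by norm_num, ← pow_mul, ← pow_mul]
                ring
          refine h3.trans (Nat.mul_le_mul_left _ ?_)
          omega
        rw [div_pow, div_le_iff₀ (by positivity), mul_comm]
        exact_mod_cast h2
      rwa [div_le_iff₀ (by positivity), mul_comm] at h1
    calc (2 * a * w * 2 ^ w : ℝ) ≤ 2 * a * w * (2 ^ (a + 1) * Real.sqrt n) := by gcongr
      _ = 2 * a * 2 ^ (a + 1) * Real.sqrt n * w := by ring
      _ ≤ _ := by gcongr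
  · have hsize := two_pow_le_size_of_isRun blk e (u := 2 ^ u) hC (Nat.two_pow_pos w) huB
      (influence_gap (by omega) hJ) (by
        have := error_gap (N := Fintype.card (Fin B × Fin (4 ^ (a + 1)))) ha1 ha (hw ▸ hJ)
        rw [← hw] at this
        exact this) hg hm
    have hL2 : 2 ≤ Real.logb 2 s := by
      rw [Real.le_logb_iff_rpow_le (by norm_num) hs0]
      norm_num
      exact_mod_cast hs_ge
    have hLw : Real.logb 2 s ≤ 2 * a * w * 2 ^ w := by
      rwa [Real.logb_le_iff_le_rpow (by norm_num) hs0]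
    have hkey := sq_div_logb_cube_le ha1 hL2 hLw
    have hsize' : (2 : ℝ) ^ (2 ^ u * 2 ^ w - w) ≤ (g m).size := by exact_mod_cast hsize
    refine le_trans ?_ hsize'
    set L := Real.logb 2 s with hL
    have hsL : (s : ℝ) = 2 ^ L := (Real.rpow_logb (by norm_num) (by norm_num) hs0).symm
    rw [hsL, ← Real.rpow_mul (by norm_num),
      ← Real.rpow_natCast 2 (2 ^ u * 2 ^ w - w)]
    refine Real.rpow_le_rpow_of_exponent_le (by norm_num) ?_
    have hdepth : (4 : ℝ) ^ w / 2 ^ (3 * a + 3) ≤ ((2 ^ u * 2 ^ w - w : ℕ) : ℝ) := by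
      have h1 : 2 * w ≤ 2 ^ w := by
        obtain ⟨v, rfl⟩ : ∃ v, w = v + 1 := ⟨w - 1, by omega⟩
        have := Nat.lt_two_pow_self (n := v)
        rw [pow_succ]
        omega
      have h2 : 2 ^ w ≤ 2 ^ u * 2 ^ w := Nat.le_mul_of_pos_left _ (Nat.two_pow_pos u)
      have h3 : 4 ^ w = 2 ^ u * 2 ^ w * 2 ^ (3 * a + 2) := by
        rw [show 4 = 2 * 2 by norm_num, mul_pow]
        conv_lhs => rw [hw, show u + 3 * a + 2 = u + (3 * a + 2) by ring, pow_add]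
        rw [hw, show u + 3 * a + 2 = u + (3 * a + 2) by ring, pow_add]
        ring
      have h4 : 4 ^ w ≤ (2 ^ u * 2 ^ w - w) * 2 ^ (3 * a + 3) := by
        rw [h3, show 3 * a + 3 = (3 * a + 2) + 1 by ring, pow_succ 2 (3 * a + 2),
          mul_comm (2 ^ (3 * a + 2)) 2, ← mul_assoc]
        refine Nat.mul_le_mul_right _ ?_
        omega
      rw [div_le_iff₀ (by positivity)]
      exact_mod_cast h4
    refine le_trans ?_ hdepth
    calc L * (1 / (2 ^ (3 * a + 3) * (32 * a ^ 2)) * L / Real.logb 2 L ^ 3)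
        = 1 / (2 ^ (3 * a + 3) * (32 * (a : ℝ) ^ 2)) * (L ^ 2 / Real.logb 2 L ^ 3) := by ring
      _ ≤ 1 / (2 ^ (3 * a + 3) * (32 * (a : ℝ) ^ 2)) * (32 * (a : ℝ) ^ 2 * 4 ^ w) := by gcongr
      _ = (4 : ℝ) ^ w / 2 ^ (3 * a + 3) := by field_simp
  · have h1 : w < 2 ^ w := Nat.lt_two_pow_self
    omega
end
end
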